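/- arXiv:2107.10943 — 2 statements merged into one kernel-verified Lean document; each statement's English description precedes it below -/
import Mathlib

section
/- Let ρ : ℝ × ℝ³ → ℝ be smooth with compact support, and define the retarded scalar potential V(t, x) = (1/(4πε₀)) ∫_{ℝ³} ρ(t − |x − y|/c, y)/|x − y| dy. Then V is smooth on ℝ × ℝ³ and satisfies the inhomogeneous wave equation ΔV − μ₀ε₀ ∂²V/∂t² = −ρ/ε₀ everywhere. -/
noncomputable section

open Real MeasureTheory Filter

/-- Physical space `ℝ³`. -/
abbrev V3 : Type := Fin 3 → ℝ

/-- Partial derivative with respect to the time variable. -/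
def ptd {E : Type} [NormedAddCommGroup E] [NormedSpace ℝ E]
    (f : ℝ × V3 → E) : ℝ × V3 → E :=
  fun p => deriv (fun s => f (s, p.2)) p.1

/-- Partial derivative in the `i`-th spatial direction. -/
def pxd {E : Type} [NormedAddCommGroup E] [NormedSpace ℝ E]
    (i : Fin 3) (f : ℝ × V3 → E) : ℝ × V3 → E :=
  fun p => fderiv ℝ (fun y => f (p.1, y)) p.2 (Pi.single i (1 : ℝ))

/-- Spatial Laplacian. -/
def lap {E : Type} [NormedAddCommGroup E] [NormedSpace ℝ E]
    (f : ℝ × V3 → E) : ℝ × V3 → E :=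
  fun p => ∑ i : Fin 3, pxd i (pxd i f) p

/-- Spatial divergence of a vector field. -/
def divg (F : ℝ × V3 → V3) : ℝ × V3 → ℝ :=
  fun p => ∑ i : Fin 3, pxd i (fun q => F q i) p

/-- Spatial curl of a vector field. -/
def curl (F : ℝ × V3 → V3) : ℝ × V3 → V3 :=
  fun p => ![pxd 1 (fun q => F q 2) p - pxd 2 (fun q => F q 1) p,
             pxd 2 (fun q => F q 0) p - pxd 0 (fun q => F q 2) p,
             pxd 0 (fun q => F q 1) p - pxd 1 (fun q => F q 0) p]

/-- Spatial gradient of a scalar field. -/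
def grad (f : ℝ × V3 → ℝ) : ℝ × V3 → V3 :=
  fun p i => pxd i f p

/-- The d'Alembertian `□² = Δ - μ₀ε₀ ∂²/∂t²`. -/
def box (μ₀ ε₀ : ℝ) {E : Type} [NormedAddCommGroup E] [NormedSpace ℝ E]
    (f : ℝ × V3 → E) : ℝ × V3 → E :=
  fun p => lap f p - (μ₀ * ε₀) • ptd (ptd f) p

/-- Maxwell's equations for charge `ρ`, current `J` and fields `E`, `B`. -/
def Maxwell (ε₀ μ₀ : ℝ) (ρ : ℝ × V3 → ℝ) (J E B : ℝ × V3 → V3) : Prop :=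
  ∀ p : ℝ × V3,
    divg E p = ρ p / ε₀ ∧ divg B p = 0 ∧
    curl E p = -(ptd B p) ∧
    curl B p = μ₀ • J p + (μ₀ * ε₀) • ptd E p

/-- `f` is Schwartz in the spatial variable, locally uniformly in time. -/
def SchwartzLocUnif {E : Type} [NormedAddCommGroup E] [NormedSpace ℝ E]
    (f : ℝ × V3 → E) : Prop :=
  ∀ (α β : Fin 3 → ℕ) (j : ℕ) (R : ℝ), ∃ C : ℝ, ∀ p : ℝ × V3, |p.1| ≤ R →
    |∏ i : Fin 3, p.2 i ^ α i| *
      ‖(ptd^[j] ((pxd 0)^[β 0] ((pxd 1)^[β 1] ((pxd 2)^[β 2] f)))) p‖ ≤ C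

/-- Euclidean norm on `ℝ³`. -/
def norm3 (x : V3) : ℝ := Real.sqrt (∑ i : Fin 3, x i ^ 2)

/-- Dot product on `ℝ³`. -/
def dot3 (x y : V3) : ℝ := ∑ i : Fin 3, x i * y i

/-- Cross product on `ℝ³`. -/
def cross3 (a b : V3) : V3 :=
  ![a 1 * b 2 - a 2 * b 1, a 2 * b 0 - a 0 * b 2, a 0 * b 1 - a 1 * b 0]

/-- The Lorentz factor `γ_v`. -/
def gam (c : ℝ) (v : V3) : ℝ := 1 / Real.sqrt (1 - norm3 v ^ 2 / c ^ 2)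

/-- The Lorentz boost `Λ_v` with velocity `v`. -/
def boost (c : ℝ) (v : V3) (p : ℝ × V3) : ℝ × V3 :=
  (gam c v * (p.1 - dot3 v p.2 / c ^ 2),
   p.2 + ((gam c v - 1) * dot3 v p.2 / norm3 v ^ 2 - gam c v * p.1) • v)

/-- Transformed charge `ρ'_v`, i.e. the function with
`ρ'_v (Λ_v p) = γ_v (ρ p - v·J p / c²)`. -/
def rhoTr (c : ℝ) (v : V3) (ρ : ℝ × V3 → ℝ) (J : ℝ × V3 → V3) : ℝ × V3 → ℝ :=
  fun p => gam c v * (ρ (boost c (-v) p) - dot3 v (J (boost c (-v) p)) / c ^ 2)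

/-- Transformed current `J'_v`, i.e. the function with
`J'_v (Λ_v p) = J p + ((γ_v - 1)(v·J p)/|v|² - γ_v ρ p) v`. -/
def JTr (c : ℝ) (v : V3) (ρ : ℝ × V3 → ℝ) (J : ℝ × V3 → V3) : ℝ × V3 → V3 :=
  fun p => J (boost c (-v) p) +
    ((gam c v - 1) * dot3 v (J (boost c (-v) p)) / norm3 v ^ 2
      - gam c v * ρ (boost c (-v) p)) • v

/-- Transformed electric field `E''_v`, i.e. the function with
`E''_v (Λ_v p) = E_∥ p + γ_v E_⊥ p`. -/
def ETr (c : ℝ) (v : V3) (E : ℝ × V3 → V3) : ℝ × V3 → V3 :=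
  fun p =>
    (dot3 (E (boost c (-v) p)) v / norm3 v ^ 2) • v +
    gam c v • (E (boost c (-v) p) - (dot3 (E (boost c (-v) p)) v / norm3 v ^ 2) • v)

/-- Spatial gradient of a complex scalar field. -/
def gradC (f : ℝ × V3 → ℂ) : ℝ × V3 → Fin 3 → ℂ :=
  fun p i => pxd i f p

/-- Spatial divergence of a complex vector field. -/
def divgC (F : ℝ × V3 → Fin 3 → ℂ) : ℝ × V3 → ℂ :=
  fun p => ∑ i : Fin 3, pxd i (fun q => F q i) p

open Topology Set

/-- The derivative of `f` in the direction `v`. -/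
def dirD (v : ℝ × V3) (f : ℝ × V3 → ℝ) : ℝ × V3 → ℝ := fun p => fderiv ℝ f p v

/-- The integral of `f` over the backward light cone with vertex `p`, with weight `1 / |z|`. -/
def conePotential (c : ℝ) (f : ℝ × V3 → ℝ) (p : ℝ × V3) : ℝ :=
  ∫ z : V3, (norm3 z)⁻¹ * f (p - (norm3 z / c, z))

lemma contDiff_dirD {f : ℝ × V3 → ℝ} (hf : ContDiff ℝ (⊤ : ℕ∞) f) (v : ℝ × V3) :
    ContDiff ℝ (⊤ : ℕ∞) (dirD v f) :=
  (hf.fderiv_right (m := (⊤ : ℕ∞)) (by simp)).clm_apply contDiff_const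

lemma hasCompactSupport_dirD {f : ℝ × V3 → ℝ} (hf : HasCompactSupport f) (v : ℝ × V3) :
    HasCompactSupport (dirD v f) :=
  hf.fderiv_apply ℝ v

lemma continuous_norm3 : Continuous norm3 := by
  unfold norm3; fun_prop

lemma norm3_nonneg (z : V3) : 0 ≤ norm3 z := Real.sqrt_nonneg _

lemma norm_sq_le_sum_sq (z : V3) : ‖z‖ ^ 2 ≤ ∑ i : Fin 3, z i ^ 2 := by
  obtain ⟨i, hi⟩ : ∃ i, ‖z‖ = ‖z i‖ := by
    obtain ⟨i, hi⟩ := Finite.exists_max (fun i => ‖z i‖)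
    exact ⟨i, le_antisymm ((pi_norm_le_iff_of_nonneg (norm_nonneg _)).2 hi) (norm_le_pi_norm z i)⟩
  rw [hi, Real.norm_eq_abs, sq_abs]
  exact Finset.single_le_sum (f := fun i => z i ^ 2) (fun j _ => sq_nonneg _) (Finset.mem_univ i)

lemma norm_le_norm3 (z : V3) : ‖z‖ ≤ norm3 z :=
  Real.le_sqrt_of_sq_le (norm_sq_le_sum_sq z)

lemma norm3_pos {z : V3} (hz : z ≠ 0) : 0 < norm3 z :=
  (norm_pos_iff.2 hz).trans_le (norm_le_norm3 z)

lemma integrable_indicator_norm3_inv (R : ℝ) :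
    Integrable ((Metric.ball (0 : V3) R).indicator fun z => (norm3 z)⁻¹) := by
  have h : Integrable (fun z : V3 => (Iio R).indicator (fun r : ℝ => r⁻¹) ‖z‖) := by
    rw [integrable_fun_norm_addHaar volume (f := (Iio R).indicator (fun r : ℝ => r⁻¹))]
    have h1 : IntegrableOn (fun y : ℝ => y) (Ioo 0 R) :=
      (continuous_id.integrableOn_Icc (a := 0) (b := R)).mono_set Ioo_subset_Icc_self
    rw [← integrable_indicator_iff measurableSet_Ioo] at h1
    rw [← integrable_indicator_iff measurableSet_Ioi]
    refine h1.congr (Eventually.of_forall fun y => ?_)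
    by_cases h0 : 0 < y
    · by_cases hR : y < R
      · simp [indicator, h0, hR]
        field_simp
      · simp [indicator, hR]
    · simp [indicator, h0]
  refine h.mono' ?_ (Eventually.of_forall fun z => ?_)
  · exact ((continuous_norm3.measurable.inv).indicator measurableSet_ball).aestronglyMeasurable
  · by_cases hz : ‖z‖ < R
    · simp only [indicator, Metric.mem_ball, dist_zero_right, hz, if_true, mem_Iio]
      rw [Real.norm_of_nonneg (inv_nonneg.2 (norm3_nonneg z))]
      rcases eq_or_ne z 0 with rfl | h0
      · simp [norm3]
      · exact inv_anti₀ (norm_pos_iff.2 h0) (norm_le_norm3 z)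
    · simp [indicator, hz]

lemma integrable_norm3_inv_smul {E : Type} [NormedAddCommGroup E] [NormedSpace ℝ E]
    {g : V3 → E} (hg : Continuous g) {C R : ℝ}
    (hC : ∀ z, ‖g z‖ ≤ C) (hR : ∀ z, R ≤ ‖z‖ → g z = 0) :
    Integrable (fun z => (norm3 z)⁻¹ • g z) := by
  refine ((integrable_indicator_norm3_inv R).const_mul C).mono' ?_
    (Eventually.of_forall fun z => ?_)
  · exact (continuous_norm3.measurable.inv.aestronglyMeasurable).smul hg.aestronglyMeasurable
  · rw [norm_smul, Real.norm_of_nonneg (inv_nonneg.2 (norm3_nonneg z))]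
    by_cases hz : ‖z‖ < R
    · simp only [indicator, Metric.mem_ball, dist_zero_right, hz, if_true]
      rw [mul_comm]
      exact mul_le_mul_of_nonneg_right (hC z) (inv_nonneg.2 (norm3_nonneg z))
    · simp [indicator, hz, hR z (not_lt.1 hz)]

lemma exists_bound_radius {E : Type} [NormedAddCommGroup E] {f : ℝ × V3 → E} (hf : Continuous f)
    (hs : HasCompactSupport f) :
    ∃ C R : ℝ, (∀ q, ‖f q‖ ≤ C) ∧ ∀ q, R ≤ ‖q.2‖ → f q = 0 := by
  obtain ⟨C, hC⟩ := hf.bounded_above_of_compact_support hs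
  obtain ⟨R, hR⟩ := hs.isCompact.isBounded.exists_norm_le
  refine ⟨C, R + 1, hC, fun q hq => ?_⟩
  by_contra h
  have := hR q (subset_tsupport f h)
  have := norm_snd_le q
  linarith

lemma integrable_cone {E : Type} [NormedAddCommGroup E] [NormedSpace ℝ E] (c : ℝ)
    {f : ℝ × V3 → E} (hf : Continuous f) (hs : HasCompactSupport f) (p : ℝ × V3) :
    Integrable (fun z => (norm3 z)⁻¹ • f (p - (norm3 z / c, z))) := by
  obtain ⟨C, R, hC, hR⟩ := exists_bound_radius hf hs
  have := continuous_norm3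
  refine integrable_norm3_inv_smul (C := C) (R := R + ‖p.2‖) (by fun_prop) (fun z => hC _)
    fun z hz => hR _ ?_
  have := norm_sub_norm_le z p.2
  rw [norm_sub_rev] at this
  simp only [Prod.snd_sub]
  linarith

lemma hasFDerivAt_conePotential (c : ℝ) {f : ℝ × V3 → ℝ} (hf : ContDiff ℝ (⊤ : ℕ∞) f)
    (hs : HasCompactSupport f) (p : ℝ × V3) :
    HasFDerivAt (conePotential c f)
      (∫ z : V3, (norm3 z)⁻¹ • fderiv ℝ f (p - (norm3 z / c, z))) p := by
  have hf' : Continuous (fderiv ℝ f) := hf.continuous_fderiv (by simp)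
  obtain ⟨C, R, hC, hR⟩ := exists_bound_radius hf' (hs.fderiv ℝ)
  have hn := continuous_norm3
  have hi : ∀ p, Integrable (fun z => (norm3 z)⁻¹ * f (p - (norm3 z / c, z))) :=
    fun p => integrable_cone c hf.continuous hs p
  refine hasFDerivAt_integral_of_dominated_of_fderiv_le
    (F' := fun p z => (norm3 z)⁻¹ • fderiv ℝ f (p - (norm3 z / c, z)))
    (bound := fun z => C * (Metric.ball (0 : V3) (R + ‖p.2‖ + 1)).indicator
      (fun z => (norm3 z)⁻¹) z)
    (Metric.ball_mem_nhds p one_pos) (Eventually.of_forall fun q => (hi q).aestronglyMeasurable)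
    (hi p) (integrable_cone c hf' (hs.fderiv ℝ) p).aestronglyMeasurable
    (Eventually.of_forall fun z q hq => ?_) ((integrable_indicator_norm3_inv _).const_mul C)
    (Eventually.of_forall fun z q _ => ?_)
  · rw [norm_smul, Real.norm_of_nonneg (inv_nonneg.2 (norm3_nonneg z)), mul_comm]
    by_cases hz : ‖z‖ < R + ‖p.2‖ + 1
    · simp only [indicator, Metric.mem_ball, dist_zero_right, hz, if_true]
      exact mul_le_mul_of_nonneg_right (hC _) (inv_nonneg.2 (norm3_nonneg z))
    · have h1 : R ≤ ‖(q - (norm3 z / c, z)).2‖ := by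
        have h2 := norm_sub_norm_le z q.2
        rw [norm_sub_rev] at h2
        have h3 : ‖q.2 - p.2‖ ≤ ‖q - p‖ := norm_snd_le (q - p)
        have h4 := norm_sub_norm_le q.2 p.2
        rw [Metric.mem_ball, dist_eq_norm] at hq
        simp only [Prod.snd_sub]
        linarith
      simp [indicator, hz, hR _ h1]
  · have h := ((hf.differentiable (by simp)) (q - (norm3 z / c, z))).hasFDerivAt.comp q
      ((hasFDerivAt_id q).sub_const (norm3 z / c, z))
    simpa using! h.const_mul (norm3 z)⁻¹

lemma dirD_conePotential (c : ℝ) {f : ℝ × V3 → ℝ} (hf : ContDiff ℝ (⊤ : ℕ∞) f)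
    (hs : HasCompactSupport f) (v : ℝ × V3) :
    dirD v (conePotential c f) = conePotential c (dirD v f) := by
  ext p
  have hf' : Continuous (fderiv ℝ f) := hf.continuous_fderiv (by simp)
  rw [dirD, (hasFDerivAt_conePotential c hf hs p).fderiv,
    ContinuousLinearMap.integral_apply (integrable_cone c hf' (hs.fderiv ℝ) p)]
  rfl

lemma contDiff_conePotential (c : ℝ) {f : ℝ × V3 → ℝ} (hf : ContDiff ℝ (⊤ : ℕ∞) f)
    (hs : HasCompactSupport f) : ContDiff ℝ (⊤ : ℕ∞) (conePotential c f) := by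
  refine contDiff_infty.2 fun n => ?_
  induction n generalizing f with
  | zero =>
    exact contDiff_zero.2 (continuous_iff_continuousAt.2 fun p =>
      (hasFDerivAt_conePotential c hf hs p).continuousAt)
  | succ n ih =>
    push_cast
    refine (contDiff_succ_iff_fderiv_apply (n := n)).2
      ⟨fun p => (hasFDerivAt_conePotential c hf hs p).differentiableAt, by simp, fun v => ?_⟩
    have := ih (contDiff_dirD hf v) (hasCompactSupport_dirD hs v)
    rwa [← dirD_conePotential c hf hs v] at this

/-- The regularised Euclidean norm `√(|z|² + a²)`. -/
def regNorm (a : ℝ) (z : V3) : ℝ := Real.sqrt (∑ i : Fin 3, z i ^ 2 + a ^ 2)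

lemma continuous_regNorm (a : ℝ) : Continuous (regNorm a) := by
  unfold regNorm; fun_prop

lemma sum_sq_nonneg (z : V3) : 0 ≤ ∑ i : Fin 3, z i ^ 2 :=
  Finset.sum_nonneg fun _ _ => sq_nonneg _

lemma regNorm_pos {a : ℝ} (ha : 0 < a) (z : V3) : 0 < regNorm a z := by
  have := sum_sq_nonneg z
  exact Real.sqrt_pos.2 (by positivity)

lemma regNorm_sq (a : ℝ) (z : V3) : regNorm a z ^ 2 = ∑ i : Fin 3, z i ^ 2 + a ^ 2 :=
  Real.sq_sqrt (add_nonneg (sum_sq_nonneg z) (sq_nonneg a))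

lemma norm3_le_regNorm (a : ℝ) (z : V3) : norm3 z ≤ regNorm a z :=
  Real.sqrt_le_sqrt (le_add_of_nonneg_right (sq_nonneg a))

lemma regNorm_smul {a : ℝ} (ha : 0 < a) (z : V3) : regNorm a (a • z) = a * regNorm 1 z := by
  rw [regNorm, regNorm, ← Real.sqrt_sq ha.le, ← Real.sqrt_mul (sq_nonneg _), Real.sqrt_sq ha.le]
  congr 1
  simp only [Pi.smul_apply, smul_eq_mul, Fin.sum_univ_three]
  ring

/-- The `i`-th spatial unit vector in space-time. -/
def ex (i : Fin 3) : ℝ × V3 := (0, Pi.single i 1)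

/-- The unit time vector in space-time. -/
def et : ℝ × V3 := (1, 0)

lemma hasDerivAt_regNorm_line {a : ℝ} (ha : 0 < a) (z : V3) (i : Fin 3) :
    HasDerivAt (fun t : ℝ => regNorm a (z + t • Pi.single i 1)) (z i / regNorm a z) 0 := by
  have h1 : HasDerivAt (fun t : ℝ => ∑ j : Fin 3, (z + t • (Pi.single i 1 : V3)) j ^ 2 + a ^ 2)
      (2 * z i) 0 := by
    have h2 : ∀ j : Fin 3, HasDerivAt (fun t : ℝ => (z + t • (Pi.single i 1 : V3)) j ^ 2)
        (2 * z j * (Pi.single i 1 : V3) j) 0 := fun j => by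
      have := (((hasDerivAt_id (0 : ℝ)).mul_const ((Pi.single i 1 : V3) j)).const_add (z j)).pow 2
      simpa using! this
    have h3 := (HasDerivAt.fun_sum fun j (_ : j ∈ Finset.univ) => h2 j).add_const (a ^ 2)
    refine h3.congr_deriv ?_
    simp [Pi.single_apply]
  have h := h1.sqrt (by simpa using! (regNorm_sq a z ▸ (pow_pos (regNorm_pos ha z) 2)).ne')
  refine h.congr_deriv ?_
  simp only [zero_smul, add_zero]
  rw [mul_div_mul_left _ _ two_ne_zero, regNorm]

lemma hasDerivAt_comp_regNorm_line {a c : ℝ} (ha : 0 < a) {f : ℝ × V3 → ℝ}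
    (hf : Differentiable ℝ f) (z : V3) (i : Fin 3) :
    HasDerivAt (fun t : ℝ => f (regNorm a (z + t • Pi.single i 1) / c, z + t • Pi.single i 1))
      (dirD et f (regNorm a z / c, z) * (z i / regNorm a z / c)
        + dirD (ex i) f (regNorm a z / c, z)) 0 := by
  have h1 : HasDerivAt (fun t : ℝ => z + t • (Pi.single i 1 : V3)) (Pi.single i 1) 0 := by
    simpa using! ((hasDerivAt_id (0 : ℝ)).smul_const (Pi.single i 1 : V3)).const_add z
  have h2 := ((hasDerivAt_regNorm_line ha z i).div_const c).prodMk h1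
  have h3 := (hf (regNorm a (z + (0 : ℝ) • Pi.single i 1) / c,
    z + (0 : ℝ) • Pi.single i 1)).hasFDerivAt.comp_hasDerivAt (0 : ℝ) h2
  refine h3.congr_deriv ?_
  have h4 : ((z i / regNorm a z / c, Pi.single i 1) : ℝ × V3)
      = (z i / regNorm a z / c) • et + ex i := by
    ext <;> simp [et, ex]
  rw [h4, map_add, map_smul, smul_eq_mul, mul_comm]
  simp [dirD]

/-- The `i`-th component of a vector field whose divergence is a regularisation of the
d'Alembertian of `f` on the light cone. -/
def coneField (a c : ℝ) (f : ℝ × V3 → ℝ) (i : Fin 3) (z : V3) : ℝ :=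
  dirD (ex i) f (regNorm a z / c, z) / regNorm a z
    - dirD et f (regNorm a z / c, z) * z i / (c * regNorm a z ^ 2)
    + f (regNorm a z / c, z) * z i / regNorm a z ^ 3

/-- The derivative of `coneField a c f i` in the `i`-th direction. -/
def coneFieldDeriv (a c : ℝ) (f : ℝ × V3 → ℝ) (i : Fin 3) (z : V3) : ℝ :=
  let r := regNorm a z
  let q : ℝ × V3 := (r / c, z)
  dirD (ex i) (dirD (ex i) f) q / r
    + dirD et (dirD (ex i) f) q * z i / (c * r ^ 2)
    - dirD (ex i) f q * z i / r ^ 3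
    - dirD (ex i) (dirD et f) q * z i / (c * r ^ 2)
    - dirD et (dirD et f) q * z i ^ 2 / (c ^ 2 * r ^ 3)
    - dirD et f q / (c * r ^ 2)
    + 3 * dirD et f q * z i ^ 2 / (c * r ^ 4)
    + dirD (ex i) f q * z i / r ^ 3
    + f q / r ^ 3
    - 3 * f q * z i ^ 2 / r ^ 5

lemma hasLineDerivAt_coneField {a c : ℝ} (ha : 0 < a) (hc : 0 < c) {f : ℝ × V3 → ℝ}
    (hf : ContDiff ℝ (⊤ : ℕ∞) f) (i : Fin 3) (z : V3) :
    HasLineDerivAt ℝ (coneField a c f i) (coneFieldDeriv a c f i z) z (Pi.single i 1) := by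
  have hd : ∀ {g : ℝ × V3 → ℝ}, ContDiff ℝ (⊤ : ℕ∞) g → Differentiable ℝ g :=
    fun hg => hg.differentiable (by simp)
  have hr := regNorm_pos ha z
  have hr0 : regNorm a (z + (0 : ℝ) • Pi.single i 1) ≠ 0 := by simpa using hr.ne'
  have h0 := hasDerivAt_comp_regNorm_line (c := c) ha (hd hf) z i
  have ht := hasDerivAt_comp_regNorm_line (c := c) ha (hd (contDiff_dirD hf et)) z i
  have hx := hasDerivAt_comp_regNorm_line (c := c) ha (hd (contDiff_dirD hf (ex i))) z i
  have hn := hasDerivAt_regNorm_line ha z i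
  have hz : HasDerivAt (fun t : ℝ => (z + t • (Pi.single i 1 : V3)) i) 1 0 := by
    simpa using! ((hasDerivAt_id (0 : ℝ)).mul_const ((Pi.single i 1 : V3) i)).const_add (z i)
  have h := ((hx.fun_div hn hr0).fun_sub ((ht.fun_mul hz).fun_div ((hn.fun_pow 2).const_mul c)
    (mul_ne_zero hc.ne' (pow_ne_zero 2 hr0)))).fun_add
      ((h0.fun_mul hz).fun_div (hn.fun_pow 3) (pow_ne_zero 3 hr0))
  unfold HasLineDerivAt
  refine h.congr_deriv ?_
  simp only [zero_smul, add_zero, coneFieldDeriv]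
  field_simp
  push_cast
  ring

lemma sum_coneFieldDeriv {a c : ℝ} (ha : 0 < a) (hc : 0 < c) {f : ℝ × V3 → ℝ}
    (hf : ContDiff ℝ (⊤ : ℕ∞) f) (z : V3) :
    ∑ i, coneFieldDeriv a c f i z =
      ((regNorm a z)⁻¹ * ∑ i, dirD (ex i) (dirD (ex i) f) (regNorm a z / c, z)
        - (∑ i, z i ^ 2) / (c ^ 2 * regNorm a z ^ 3) * dirD et (dirD et f) (regNorm a z / c, z))
      - (3 * a ^ 2 / (c * regNorm a z ^ 4) * dirD et f (regNorm a z / c, z)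
        - 3 * a ^ 2 / regNorm a z ^ 5 * f (regNorm a z / c, z)) := by
  have hcomm : ∀ (u v : ℝ × V3) q, dirD u (dirD v f) q = dirD v (dirD u f) q := by
    intro u v q
    have hs : IsSymmSndFDerivAt ℝ f q := hf.contDiffAt.isSymmSndFDerivAt
      (by simpa using (WithTop.coe_le_coe.2 (le_top : (2 : ℕ∞) ≤ ⊤)))
    have h : ∀ u v : ℝ × V3, dirD u (dirD v f) q = fderiv ℝ (fderiv ℝ f) q u v := by
      intro u v
      have hd : DifferentiableAt ℝ (fderiv ℝ f) q :=
        (hf.fderiv_right (m := (⊤ : ℕ∞)) (by simp)).differentiable (by simp) q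
      unfold dirD
      rw [fderiv_clm_apply hd (differentiableAt_const v)]
      simp
    rw [h, h, hs]
  have hr := regNorm_pos ha z
  have hsq := regNorm_sq a z
  simp only [coneFieldDeriv, hcomm et]
  generalize regNorm a z = r at *
  simp only [Fin.sum_univ_three] at *
  have ha2 : a ^ 2 = r ^ 2 - (z 0 ^ 2 + z 1 ^ 2 + z 2 ^ 2) := by linarith
  rw [ha2]
  field_simp
  ring

lemma integral_lineDeriv_eq_zero {g g' : V3 → ℝ} {v : V3} (hg : Integrable g)
    (hg' : Integrable g') (h : ∀ z, HasLineDerivAt ℝ g (g' z) z v) : ∫ z, g' z = 0 := by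
  have := integral_bilinear_hasLineDerivAt_right_eq_neg_left_of_integrable (μ := volume)
    (f := fun _ : V3 => (1 : ℝ)) (f' := fun _ => 0) (g := g) (g' := g') (v := v)
    (B := ContinuousLinearMap.mul ℝ ℝ) (by simp) (by simpa using hg') (by simpa using hg)
    (fun x _ => by simpa [HasLineDerivAt] using! hasDerivAt_const (0 : ℝ) (1 : ℝ)) (fun x _ => h x)
  simpa using this

lemma integrable_mul_comp_regNorm {a c : ℝ} {f : ℝ × V3 → ℝ} (hf : Continuous f)
    (hs : HasCompactSupport f) {w : V3 → ℝ} (hw : Continuous w) :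
    Integrable fun z => w z * f (regNorm a z / c, z) := by
  obtain ⟨C, R, -, hR⟩ := exists_bound_radius hf hs
  have := continuous_regNorm a
  refine Continuous.integrable_of_hasCompactSupport (by fun_prop)
    (HasCompactSupport.intro (isCompact_closedBall (0 : V3) R) fun z hz => ?_)
  rw [Metric.mem_closedBall, dist_zero_right, not_le] at hz
  rw [hR _ hz.le, mul_zero]

lemma integral_regularised_identity {a c : ℝ} (ha : 0 < a) (hc : 0 < c) {f : ℝ × V3 → ℝ}
    (hf : ContDiff ℝ (⊤ : ℕ∞) f) (hs : HasCompactSupport f) :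
    ∫ z : V3, ((regNorm a z)⁻¹ * ∑ i, dirD (ex i) (dirD (ex i) f) (regNorm a z / c, z)
        - (∑ i, z i ^ 2) / (c ^ 2 * regNorm a z ^ 3) * dirD et (dirD et f) (regNorm a z / c, z))
      = ∫ z : V3, (3 * a ^ 2 / (c * regNorm a z ^ 4) * dirD et f (regNorm a z / c, z)
        - 3 * a ^ 2 / regNorm a z ^ 5 * f (regNorm a z / c, z)) := by
  have hn := continuous_regNorm a
  have hn0 : ∀ z, regNorm a z ≠ 0 := fun z => (regNorm_pos ha z).ne'
  have hI : ∀ {g : ℝ × V3 → ℝ}, ContDiff ℝ (⊤ : ℕ∞) g → HasCompactSupport g →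
      ∀ {w : V3 → ℝ}, Continuous w → Integrable fun z => w z * g (regNorm a z / c, z) :=
    fun hg hgs _ hw => integrable_mul_comp_regNorm hg.continuous hgs hw
  have hw : ∀ (i : Fin 3) (k : ℝ) (m n : ℕ),
      Continuous fun z : V3 => k * z i ^ m / regNorm a z ^ n :=
    fun i k m n => by
      refine Continuous.div (by fun_prop) (by fun_prop) fun z => pow_ne_zero _ (hn0 z)
  have h1 := fun v => contDiff_dirD hf v
  have h2 := fun u v => contDiff_dirD (contDiff_dirD hf v) u
  have s1 := fun v => hasCompactSupport_dirD hs v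
  have s2 := fun u v => hasCompactSupport_dirD (hasCompactSupport_dirD hs v) u
  have hF : ∀ i, Integrable (coneField a c f i) := fun i => by
    refine (((hI (h1 (ex i)) (s1 _) (hw i 1 0 1)).sub (hI (h1 et) (s1 _) (hw i c⁻¹ 1 2))).add
      (hI hf hs (hw i 1 1 3))).congr (Eventually.of_forall fun z => ?_)
    have := hn0 z
    simp only [coneField, Pi.add_apply, Pi.sub_apply]
    field_simp
  have hF' : ∀ i, Integrable (coneFieldDeriv a c f i) := fun i => by
    refine ((((((((((hI (h2 (ex i) (ex i)) (s2 _ _) (hw i 1 0 1)).add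
      (hI (h2 et (ex i)) (s2 _ _) (hw i c⁻¹ 1 2))).sub
      (hI (h1 (ex i)) (s1 _) (hw i 1 1 3))).sub
      (hI (h2 (ex i) et) (s2 _ _) (hw i c⁻¹ 1 2))).sub
      (hI (h2 et et) (s2 _ _) (hw i (c⁻¹ ^ 2) 2 3))).sub
      (hI (h1 et) (s1 _) (hw i c⁻¹ 0 2))).add
      (hI (h1 et) (s1 _) (hw i (3 * c⁻¹) 2 4))).add
      (hI (h1 (ex i)) (s1 _) (hw i 1 1 3))).add
      (hI hf hs (hw i 1 0 3))).sub
      (hI hf hs (hw i 3 2 5))).congr (Eventually.of_forall fun z => ?_)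
    have := hn0 z
    simp only [coneFieldDeriv, Pi.add_apply, Pi.sub_apply]
    field_simp
  have hdiv : ∫ z, ∑ i, coneFieldDeriv a c f i z = 0 := by
    rw [integral_finsetSum _ fun i _ => hF' i]
    exact Finset.sum_eq_zero fun i _ =>
      integral_lineDeriv_eq_zero (hF i) (hF' i) (hasLineDerivAt_coneField ha hc hf i)
  simp_rw [sum_coneFieldDeriv ha hc hf] at hdiv
  rw [integral_sub, sub_eq_zero] at hdiv
  · exact hdiv
  · refine Integrable.sub ?_ ?_
    · simp_rw [Finset.mul_sum]
      exact integrable_finsetSum _ fun i _ => hI (h2 _ _) (s2 _ _) (hn.inv₀ hn0)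
    · refine hI (h2 _ _) (s2 _ _) (Continuous.div (by fun_prop) (by fun_prop) fun z => ?_)
      have := hn0 z
      positivity
  · refine Integrable.sub (hI (h1 _) (s1 _) ?_) (hI hf hs ?_)
    · refine Continuous.div (by fun_prop) (by fun_prop) fun z => ?_
      have := hn0 z
      positivity
    · refine Continuous.div (by fun_prop) (by fun_prop) fun z => ?_
      have := hn0 z
      positivity

lemma integrable_regNorm_one_pow_inv {k : ℕ} (hk : 3 < k) :
    Integrable fun z : V3 => (regNorm 1 z ^ k)⁻¹ := by
  have h : Integrable fun z : V3 => ((1 : ℝ) + ‖z‖ ^ 2) ^ (-(k : ℝ) / 2) :=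
    integrable_rpow_neg_one_add_norm_sq (by simpa using hk)
  have hn := continuous_regNorm 1
  refine h.mono' (hn.measurable.pow_const k).inv.aestronglyMeasurable
    (Eventually.of_forall fun z => ?_)
  have h1 : (0 : ℝ) < 1 + ‖z‖ ^ 2 := by positivity
  have hp := regNorm_pos one_pos z
  rw [Real.norm_of_nonneg (by positivity), neg_div, Real.rpow_neg h1.le]
  refine inv_anti₀ (Real.rpow_pos_of_pos h1 _) ?_
  have h2 : ((1 : ℝ) + ‖z‖ ^ 2) ^ ((k : ℝ) / 2) = Real.sqrt (1 + ‖z‖ ^ 2) ^ k := by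
    rw [Real.sqrt_eq_rpow, ← Real.rpow_mul_natCast h1.le]
    congr 1
    ring
  rw [h2]
  refine pow_le_pow_left₀ (Real.sqrt_nonneg _) (Real.sqrt_le_sqrt ?_) k
  have := norm_sq_le_sum_sq z
  linarith

lemma integral_Ioi_sq_div_sqrt_pow_five :
    ∫ r in Ioi (0 : ℝ), r ^ 2 * (Real.sqrt (r ^ 2 + 1) ^ 5)⁻¹ = 1 / 3 := by
  have hpos : ∀ r : ℝ, 0 < Real.sqrt (r ^ 2 + 1) := fun r => Real.sqrt_pos.2 (by positivity)
  have hd : ∀ r : ℝ, HasDerivAt (fun r : ℝ => (r / Real.sqrt (r ^ 2 + 1)) ^ 3 / 3)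
      (r ^ 2 * (Real.sqrt (r ^ 2 + 1) ^ 5)⁻¹) r := fun r => by
    have h1 : HasDerivAt (fun r : ℝ => r ^ 2 + 1) (2 * r) r := by
      simpa using! (hasDerivAt_pow 2 r).add_const (1 : ℝ)
    have h2 := ((((hasDerivAt_id' r).fun_div (h1.sqrt (by positivity)) (hpos r).ne').fun_pow
      3).div_const 3)
    refine h2.congr_deriv ?_
    have hsq : Real.sqrt (r ^ 2 + 1) ^ 2 = r ^ 2 + 1 := Real.sq_sqrt (by positivity)
    have := (hpos r).ne'
    generalize Real.sqrt (r ^ 2 + 1) = s at *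
    norm_num
    field_simp
    linear_combination r ^ 2 * hsq
  have hlim : Tendsto (fun r : ℝ => (r / Real.sqrt (r ^ 2 + 1)) ^ 3 / 3) atTop (𝓝 (1 / 3)) := by
    have h1 : Tendsto (fun r : ℝ => Real.sqrt (1 + (r⁻¹) ^ 2)) atTop (𝓝 1) := by
      have := ((tendsto_inv_atTop_zero (𝕜 := ℝ)).pow 2).const_add 1
      simpa using this.sqrt
    have h2 : Tendsto (fun r : ℝ => r / Real.sqrt (r ^ 2 + 1)) atTop (𝓝 1) := by
      have h3 := h1.inv₀ one_ne_zero
      rw [inv_one] at h3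
      refine h3.congr' ?_
      filter_upwards [eventually_gt_atTop 0] with r hr
      have h4 : r ^ 2 + 1 = r ^ 2 * (1 + (r⁻¹) ^ 2) := by field_simp
      rw [h4, Real.sqrt_mul (sq_nonneg r), Real.sqrt_sq hr.le]
      have : Real.sqrt (1 + (r⁻¹) ^ 2) ≠ 0 := (Real.sqrt_pos.2 (by positivity)).ne'
      field_simp
    simpa using (h2.pow 3).div_const 3
  have := integral_Ioi_of_hasDerivAt_of_nonneg' (a := 0) (fun r _ => hd r)
    (fun r _ => by have := hpos r; positivity) hlim
  simpa using this

lemma integral_regNorm_one_pow_five_inv :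
    ∫ z : V3, (regNorm 1 z ^ 5)⁻¹ = 4 * Real.pi / 3 := by
  have h1 : ∫ z : V3, (regNorm 1 z ^ 5)⁻¹
      = ∫ x : EuclideanSpace ℝ (Fin 3), (Real.sqrt (‖x‖ ^ 2 + 1) ^ 5)⁻¹ := by
    rw [← (EuclideanSpace.volume_preserving_symm_measurableEquiv_toLp (Fin 3)).integral_comp
      (MeasurableEquiv.measurableEmbedding _)]
    refine integral_congr_ae (Eventually.of_forall fun x => ?_)
    simp [regNorm, EuclideanSpace.norm_sq_eq]
  rw [h1, integral_fun_norm_addHaar volume fun r => (Real.sqrt (r ^ 2 + 1) ^ 5)⁻¹]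
  simp only [finrank_euclideanSpace, Fintype.card_fin, Measure.real,
    EuclideanSpace.volume_ball_fin_three, Nat.add_one_sub_one, smul_eq_mul,
    integral_Ioi_sq_div_sqrt_pow_five]
  rw [ENNReal.ofReal_one, one_pow, one_mul, ENNReal.toReal_ofReal (by positivity)]
  simp only [nsmul_eq_mul]
  push_cast
  ring

lemma tendsto_regNorm (z : V3) : Tendsto (fun a => regNorm a z) (𝓝[>] 0) (𝓝 (norm3 z)) := by
  have h : Continuous fun a => regNorm a z := by unfold regNorm; fun_prop
  have h0 : regNorm 0 z = norm3 z := by simp [regNorm, norm3]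
  exact h0 ▸ (h.tendsto 0).mono_left nhdsWithin_le_nhds

lemma tendsto_integral_regularised_box {c : ℝ} (hc : 0 < c) {g h : ℝ × V3 → ℝ}
    (hg : Continuous g) (hgs : HasCompactSupport g) (hh : Continuous h)
    (hhs : HasCompactSupport h) :
    Tendsto (fun a => ∫ z : V3, ((regNorm a z)⁻¹ * g (regNorm a z / c, z)
        - (∑ i, z i ^ 2) / (c ^ 2 * regNorm a z ^ 3) * h (regNorm a z / c, z))) (𝓝[>] 0)
      (𝓝 (∫ z : V3, (norm3 z)⁻¹ *
        (g (norm3 z / c, z) - (c ^ 2)⁻¹ * h (norm3 z / c, z)))) := by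
  obtain ⟨C, R, hC, hR⟩ := exists_bound_radius hg hgs
  obtain ⟨C', R', hC', hR'⟩ := exists_bound_radius hh hhs
  have h_ne : ∀ᵐ z : V3, z ≠ 0 := by simp [ae_iff]
  refine tendsto_integral_filter_of_dominated_convergence
    (fun z => (C + C' / c ^ 2) * (Metric.ball (0 : V3) (max R R')).indicator
      (fun z => (norm3 z)⁻¹) z) ?_ ?_ ((integrable_indicator_norm3_inv _).const_mul _) ?_
  · refine Eventually.of_forall fun a => ?_
    have hn := continuous_regNorm a
    refine Measurable.aestronglyMeasurable ?_
    have m1 : Measurable fun z : V3 => g (regNorm a z / c, z) :=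
      Continuous.measurable (by fun_prop)
    have m2 : Measurable fun z : V3 => h (regNorm a z / c, z) :=
      Continuous.measurable (by fun_prop)
    have m3 := hn.measurable
    fun_prop
  · filter_upwards [self_mem_nhdsWithin] with a (ha : 0 < a)
    filter_upwards [h_ne] with z hz
    by_cases hzR : ‖z‖ < max R R'
    · simp only [indicator, Metric.mem_ball, dist_zero_right, hzR, if_true]
      have hp := norm3_pos hz
      have hr := regNorm_pos ha z
      have hle := norm3_le_regNorm a z
      have hN : ∑ i, z i ^ 2 ≤ regNorm a z ^ 2 := by
        rw [regNorm_sq]; linarith [sq_nonneg a]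
      have hN0 := sum_sq_nonneg z
      have hinv : (regNorm a z)⁻¹ ≤ (norm3 z)⁻¹ := inv_anti₀ hp hle
      have hinv0 : 0 ≤ (norm3 z)⁻¹ := (inv_pos.2 hp).le
      have hw : (∑ i, z i ^ 2) / (c ^ 2 * regNorm a z ^ 3) ≤ (c ^ 2)⁻¹ * (norm3 z)⁻¹ := by
        refine le_trans ?_ (mul_le_mul_of_nonneg_left hinv (by positivity))
        rw [div_le_iff₀ (by positivity)]
        calc _ ≤ regNorm a z ^ 2 := hN
          _ = _ := by field_simp
      refine (norm_sub_le _ _).trans ?_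
      rw [norm_mul, norm_mul, Real.norm_of_nonneg (inv_pos.2 hr).le,
        Real.norm_of_nonneg (by positivity : 0 ≤ (∑ i, z i ^ 2) / (c ^ 2 * regNorm a z ^ 3))]
      calc _ ≤ (norm3 z)⁻¹ * C + (c ^ 2)⁻¹ * (norm3 z)⁻¹ * C' :=
            add_le_add (mul_le_mul hinv (hC _) (norm_nonneg _) hinv0)
              (mul_le_mul hw (hC' _) (norm_nonneg _) (by positivity))
        _ = _ := by ring
    · have h1 := max_le_iff.1 (not_lt.1 hzR)
      simp [indicator, hzR, hR (regNorm a z / c, z) h1.1, hR' (regNorm a z / c, z) h1.2]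
  · filter_upwards [h_ne] with z hz
    have hp := norm3_pos hz
    have ht := tendsto_regNorm z
    have hq : Tendsto (fun a => (regNorm a z / c, z)) (𝓝[>] 0) (𝓝 (norm3 z / c, z)) :=
      (ht.div_const c).prodMk_nhds tendsto_const_nhds
    have hdiv := (tendsto_const_nhds (x := ∑ i, z i ^ 2)).div ((ht.pow 3).const_mul (c ^ 2))
      (by positivity)
    have hlim := ((ht.inv₀ hp.ne').mul ((hg.tendsto _).comp hq)).sub
      (hdiv.mul ((hh.tendsto _).comp hq))
    refine le_of_le_of_eq hlim (congrArg 𝓝 ?_)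
    have hN : ∑ i, z i ^ 2 = norm3 z ^ 2 := (Real.sq_sqrt (sum_sq_nonneg z)).symm
    rw [hN]
    field_simp

lemma tendsto_integral_regularised_delta {c : ℝ} (hc : 0 < c) {f g : ℝ × V3 → ℝ}
    (hf : Continuous f) (hs : HasCompactSupport f) (hg : Continuous g)
    (hgs : HasCompactSupport g) :
    Tendsto (fun a => ∫ z : V3, (3 * a ^ 2 / (c * regNorm a z ^ 4) * g (regNorm a z / c, z)
        - 3 * a ^ 2 / regNorm a z ^ 5 * f (regNorm a z / c, z))) (𝓝[>] 0)
      (𝓝 (-(4 * Real.pi * f 0))) := by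
  obtain ⟨C, hC⟩ := hf.bounded_above_of_compact_support hs
  obtain ⟨C', hC'⟩ := hg.bounded_above_of_compact_support hgs
  have hn := continuous_regNorm 1
  have hscale : ∀ a : ℝ, 0 < a →
      ∫ z : V3, (3 * a / c * (regNorm 1 z ^ 4)⁻¹ * g (a * regNorm 1 z / c, a • z)
        - 3 * (regNorm 1 z ^ 5)⁻¹ * f (a * regNorm 1 z / c, a • z)) =
      ∫ z : V3, (3 * a ^ 2 / (c * regNorm a z ^ 4) * g (regNorm a z / c, z)
        - 3 * a ^ 2 / regNorm a z ^ 5 * f (regNorm a z / c, z)) := by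
    intro a ha
    have h := Measure.integral_comp_smul volume (fun z : V3 =>
      3 * a ^ 2 / (c * regNorm a z ^ 4) * g (regNorm a z / c, z)
        - 3 * a ^ 2 / regNorm a z ^ 5 * f (regNorm a z / c, z)) a
    simp only [Module.finrank_fin_fun, smul_eq_mul] at h
    rw [abs_of_pos (by positivity), eq_comm, inv_mul_eq_iff_eq_mul₀ (by positivity)] at h
    rw [h, ← integral_const_mul]
    refine integral_congr_ae (Eventually.of_forall fun z => ?_)
    have := regNorm_pos one_pos z
    simp only [regNorm_smul ha]
    field_simp
  have hlim : Tendsto (fun a : ℝ =>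
      ∫ z : V3, (3 * a / c * (regNorm 1 z ^ 4)⁻¹ * g (a * regNorm 1 z / c, a • z)
        - 3 * (regNorm 1 z ^ 5)⁻¹ * f (a * regNorm 1 z / c, a • z))) (𝓝[>] 0)
      (𝓝 (∫ z : V3, (-3 * f 0) * (regNorm 1 z ^ 5)⁻¹)) := by
    refine tendsto_integral_filter_of_dominated_convergence
      (fun z => 3 / c * C' * (regNorm 1 z ^ 4)⁻¹ + 3 * C * (regNorm 1 z ^ 5)⁻¹) ?_ ?_
      (((integrable_regNorm_one_pow_inv (by norm_num)).const_mul _).add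
        ((integrable_regNorm_one_pow_inv (by norm_num)).const_mul _)) ?_
    · refine Eventually.of_forall fun a => Measurable.aestronglyMeasurable ?_
      have m1 : Measurable fun z : V3 => g (a * regNorm 1 z / c, a • z) :=
        Continuous.measurable (by fun_prop)
      have m2 : Measurable fun z : V3 => f (a * regNorm 1 z / c, a • z) :=
        Continuous.measurable (by fun_prop)
      have m3 := hn.measurable
      fun_prop
    · filter_upwards [Ioo_mem_nhdsGT (one_pos : (0 : ℝ) < 1)] with a ha
      refine Eventually.of_forall fun z => ?_
      have hr := regNorm_pos one_pos z
      have ha0 := ha.1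
      refine (norm_sub_le _ _).trans ?_
      rw [norm_mul _ (g _), norm_mul _ (f _),
        Real.norm_of_nonneg (by positivity : 0 ≤ 3 * a / c * (regNorm 1 z ^ 4)⁻¹),
        Real.norm_of_nonneg (by positivity : 0 ≤ 3 * (regNorm 1 z ^ 5)⁻¹)]
      refine add_le_add ?_ ?_
      · rw [mul_right_comm (3 / c)]
        refine mul_le_mul ?_ (hC' _) (norm_nonneg _) (by positivity)
        gcongr
        linarith [ha.2]
      · rw [mul_right_comm 3]
        gcongr
        exact hC _
    · refine Eventually.of_forall fun z => ?_
      have hcont : Continuous fun a : ℝ =>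
          3 * a / c * (regNorm 1 z ^ 4)⁻¹ * g (a * regNorm 1 z / c, a • z)
            - 3 * (regNorm 1 z ^ 5)⁻¹ * f (a * regNorm 1 z / c, a • z) := by fun_prop
      have := (hcont.tendsto 0).mono_left (nhdsWithin_le_nhds (s := Ioi 0))
      convert this using 2
      simp only [mul_zero, zero_div, zero_mul, zero_smul, ← Prod.zero_eq_mk]
      ring
  rw [integral_const_mul, integral_regNorm_one_pow_five_inv] at hlim
  have h := hlim.congr' (eventually_mem_nhdsWithin.mono hscale)
  rwa [show -3 * f 0 * (4 * Real.pi / 3) = -(4 * Real.pi * f 0) by ring] at h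

lemma integral_norm3_inv_mul_box {c : ℝ} (hc : 0 < c) {f : ℝ × V3 → ℝ}
    (hf : ContDiff ℝ (⊤ : ℕ∞) f) (hs : HasCompactSupport f) :
    ∫ z : V3, (norm3 z)⁻¹ * (∑ i, dirD (ex i) (dirD (ex i) f) (norm3 z / c, z)
      - (c ^ 2)⁻¹ * dirD et (dirD et f) (norm3 z / c, z)) = -(4 * Real.pi * f 0) := by
  have h2 := fun v => contDiff_dirD (contDiff_dirD hf v) v
  have s2 := fun v => hasCompactSupport_dirD (hasCompactSupport_dirD hs v) v
  have hL : HasCompactSupport fun q => ∑ i, dirD (ex i) (dirD (ex i) f) q := by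
    simp only [Fin.sum_univ_three]
    exact ((s2 _).add (s2 _)).add (s2 _)
  have hA := tendsto_integral_regularised_box hc
    (continuous_finsetSum _ fun i _ => (h2 (ex i)).continuous) hL (h2 et).continuous (s2 et)
  refine tendsto_nhds_unique hA ((tendsto_integral_regularised_delta hc hf.continuous hs
    (contDiff_dirD hf et).continuous (hasCompactSupport_dirD hs et)).congr'
      (eventually_mem_nhdsWithin.mono fun a ha => ?_))
  exact (integral_regularised_identity ha hc hf hs).symm

lemma dirD_comp_const_sub {f : ℝ × V3 → ℝ} (hf : ContDiff ℝ (⊤ : ℕ∞) f) (p v : ℝ × V3) :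
    dirD v (fun q => f (p - q)) = fun q => -dirD v f (p - q) := by
  ext q
  have h := ((hf.differentiable (by simp)) (p - q)).hasFDerivAt.comp q
    ((hasFDerivAt_id q).const_sub p)
  rw [dirD, HasFDerivAt.fderiv (f := fun q => f (p - q)) h]
  simp [dirD]

lemma dirD_neg (f : ℝ × V3 → ℝ) (v : ℝ × V3) : dirD v (fun q => -f q) = fun q => -dirD v f q := by
  ext q
  simp [dirD, fderiv_fun_neg]

lemma conePotential_box {c : ℝ} (hc : 0 < c) {f : ℝ × V3 → ℝ}
    (hf : ContDiff ℝ (⊤ : ℕ∞) f) (hs : HasCompactSupport f) (p : ℝ × V3) :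
    ∑ i, conePotential c (dirD (ex i) (dirD (ex i) f)) p
      - (c ^ 2)⁻¹ * conePotential c (dirD et (dirD et f)) p = -(4 * Real.pi * f p) := by
  have h2 := fun v => contDiff_dirD (contDiff_dirD hf v) v
  have s2 := fun v => hasCompactSupport_dirD (hasCompactSupport_dirD hs v) v
  have hrefl : ∀ v, dirD v (dirD v fun q => f (p - q)) = fun q => dirD v (dirD v f) (p - q) := by
    intro v
    rw [dirD_comp_const_sub hf, dirD_neg, dirD_comp_const_sub (contDiff_dirD hf v)]
    simp
  have key := integral_norm3_inv_mul_box hc (f := fun q => f (p - q)) (by fun_prop)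
    (hs.comp_homeomorph (Homeomorph.subLeft p))
  simp only [hrefl, sub_zero] at key
  have hI := fun v => integrable_cone c (h2 v).continuous (s2 v) p
  simp only [smul_eq_mul] at hI
  rw [← key]
  unfold conePotential
  rw [← integral_finsetSum _ fun i _ => hI (ex i), ← integral_const_mul,
    ← integral_sub (integrable_finsetSum _ fun i _ => hI (ex i)) ((hI et).const_mul _)]
  refine integral_congr_ae (Eventually.of_forall fun z => ?_)
  simp only [← Finset.mul_sum]
  ring

lemma ptd_eq_dirD {f : ℝ × V3 → ℝ} (hf : ContDiff ℝ (⊤ : ℕ∞) f) : ptd f = dirD et f := by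
  ext p
  have h1 : HasDerivAt (fun s : ℝ => (s, p.2)) et p.1 :=
    (hasDerivAt_id p.1).prodMk (hasDerivAt_const p.1 p.2)
  exact ((hf.differentiable (by simp) p).hasFDerivAt.comp_hasDerivAt p.1 h1).deriv

lemma pxd_eq_dirD {f : ℝ × V3 → ℝ} (hf : ContDiff ℝ (⊤ : ℕ∞) f) (i : Fin 3) :
    pxd i f = dirD (ex i) f := by
  ext p
  have h1 : HasFDerivAt (fun y : V3 => (p.1, y)) (ContinuousLinearMap.inr ℝ ℝ V3) p.2 :=
    hasFDerivAt_prodMk_right p.1 p.2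
  have h2 := ((hf.differentiable (by simp) p).hasFDerivAt.comp p.2 h1).fderiv
  exact congrArg (fun L : V3 →L[ℝ] ℝ => L (Pi.single i 1)) h2

lemma dirD_const_mul {f : ℝ × V3 → ℝ} (hf : ContDiff ℝ (⊤ : ℕ∞) f) (k : ℝ) (v : ℝ × V3) :
    dirD v (fun p => k * f p) = fun p => k * dirD v f p := by
  ext p
  simp [dirD, fderiv_const_mul (hf.differentiable (by simp) p)]

lemma conePotential_eq (c : ℝ) (f : ℝ × V3 → ℝ) (p : ℝ × V3) :
    ∫ y : V3, f (p.1 - norm3 (p.2 - y) / c, y) / norm3 (p.2 - y) = conePotential c f p := by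
  obtain ⟨t, x⟩ := p
  rw [conePotential, ← integral_sub_left_eq_self _ volume x]
  refine integral_congr_ae (Eventually.of_forall fun y => ?_)
  simp only [Prod.mk_sub_mk, sub_sub_cancel, div_eq_inv_mul (f _)]

/-- the retarded scalar potential is smooth and satisfies the
inhomogeneous wave equation `ΔV - μ₀ε₀ ∂²V/∂t² = -ρ/ε₀`. -/
theorem stmt_1 (ε₀ μ₀ c : ℝ) (hε : 0 < ε₀) (hμ : 0 < μ₀)
    (hc : c = 1 / Real.sqrt (μ₀ * ε₀))
    (ρ : ℝ × V3 → ℝ) (hρ : ContDiff ℝ (⊤ : ℕ∞) ρ) (hsupp : HasCompactSupport ρ)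
    (V : ℝ × V3 → ℝ)
    (hV : V = fun p => (1 / (4 * Real.pi * ε₀)) *
      ∫ y : V3, ρ (p.1 - norm3 (p.2 - y) / c, y) / norm3 (p.2 - y)) :
    ContDiff ℝ (⊤ : ℕ∞) V ∧
      ∀ p : ℝ × V3, lap V p - μ₀ * ε₀ * ptd (ptd V) p = -(ρ p / ε₀) := by
  have hpos : 0 < μ₀ * ε₀ := mul_pos hμ hε
  have hc0 : 0 < c := hc ▸ one_div_pos.2 (Real.sqrt_pos.2 hpos)
  have hc2 : (c ^ 2)⁻¹ = μ₀ * ε₀ := by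
    rw [hc, div_pow, Real.sq_sqrt hpos.le, one_pow, one_div, inv_inv]
  simp only [conePotential_eq] at hV
  have hU := contDiff_conePotential c hρ hsupp
  have hVs : ContDiff ℝ (⊤ : ℕ∞) V := hV ▸ contDiff_const.mul hU
  have hDD : ∀ v p, dirD v (dirD v V) p =
      1 / (4 * Real.pi * ε₀) * conePotential c (dirD v (dirD v ρ)) p := by
    intro v p
    rw [hV, dirD_const_mul hU, dirD_conePotential c hρ hsupp,
      dirD_const_mul (contDiff_conePotential c (contDiff_dirD hρ v)
        (hasCompactSupport_dirD hsupp v)),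
      dirD_conePotential c (contDiff_dirD hρ v) (hasCompactSupport_dirD hsupp v)]
  refine ⟨hVs, fun p => ?_⟩
  have key := conePotential_box hc0 hρ hsupp p
  rw [hc2] at key
  have hx : lap V p = ∑ i, dirD (ex i) (dirD (ex i) V) p :=
    Finset.sum_congr rfl fun i _ => by
      rw [pxd_eq_dirD hVs, pxd_eq_dirD (contDiff_dirD hVs _)]
  rw [hx, ptd_eq_dirD hVs, ptd_eq_dirD (contDiff_dirD hVs _)]
  simp only [hDD, ← Finset.mul_sum]
  have hk : 1 / (4 * Real.pi * ε₀) * (4 * Real.pi * ρ p) = ρ p / ε₀ := by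
    have := Real.pi_pos
    field_simp
  linear_combination 1 / (4 * Real.pi * ε₀) * key - hk
end
end

section
/- Let ρ : ℝ × ℝ³ → ℝ be smooth, Schwartz in x locally uniformly in t, satisfying the wave equation □²ρ = 0 everywhere and the initial condition (∂ρ/∂t)(0, x) = 0 for all x ∈ ℝ³. Then there exist smooth fields J, E, B : ℝ × ℝ³ → ℝ³ such that: (ρ, J) satisfies the continuity equation ∂ρ/∂t + div J = 0; curl J = 0 and □²J = 0 everywhere; (ρ, J, E, B) satisfies Maxwell's equations; □²E = 0 everywhere; and B = 0 identically (so in particular the Poynting vector E × B vanishes identically). -/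
noncomputable section

open Real MeasureTheory Filter

open scoped ContDiff FourierTransform

section Calculus

variable {E : Type} [NormedAddCommGroup E] [NormedSpace ℝ E] {f g : ℝ × V3 → E}

lemma hasFDerivAt_spatial_slice (hf : ContDiff ℝ ∞ f) (p : ℝ × V3) :
    HasFDerivAt (fun y => f (p.1, y))
      ((fderiv ℝ f p).comp (ContinuousLinearMap.inr ℝ ℝ V3)) p.2 :=
  ((hf.differentiable (by simp)) p).hasFDerivAt.comp p.2 (hasFDerivAt_prodMk_right p.1 p.2)

lemma hasDerivAt_time_slice (hf : ContDiff ℝ ∞ f) (p : ℝ × V3) :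
    HasDerivAt (fun s => f (s, p.2)) (ptd f p) p.1 := by
  have h : HasFDerivAt (fun s => f (s, p.2)) _ p.1 :=
    ((hf.differentiable (by simp)) p).hasFDerivAt.comp p.1 (hasFDerivAt_prodMk_left p.1 p.2)
  exact h.differentiableAt.hasDerivAt

lemma pxd_eq_fderiv (hf : ContDiff ℝ ∞ f) (i : Fin 3) :
    pxd i f = fun p => fderiv ℝ f p (0, Pi.single i 1) := by
  funext p
  simp [pxd, (hasFDerivAt_spatial_slice hf p).fderiv]

lemma ptd_eq_fderiv (hf : ContDiff ℝ ∞ f) :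
    ptd f = fun p => fderiv ℝ f p (1, 0) := by
  funext p
  have h : HasFDerivAt (fun s => f (s, p.2)) _ p.1 :=
    ((hf.differentiable (by simp)) p).hasFDerivAt.comp p.1 (hasFDerivAt_prodMk_left p.1 p.2)
  simpa [ptd] using h.hasDerivAt.deriv

lemma contDiff_fderiv_apply_const (hf : ContDiff ℝ ∞ f) (v : ℝ × V3) :
    ContDiff ℝ ∞ (fun p => fderiv ℝ f p v) :=
  (hf.fderiv_right (m := ∞) (by simp)).clm_apply contDiff_const

lemma fderiv_fderiv_apply_comm (hf : ContDiff ℝ ∞ f) (v w p : ℝ × V3) :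
    fderiv ℝ (fun q => fderiv ℝ f q v) p w = fderiv ℝ (fun q => fderiv ℝ f q w) p v := by
  have hd : DifferentiableAt ℝ (fderiv ℝ f) p :=
    ((hf.fderiv_right (m := ∞) (by simp)).differentiable (by simp)) p
  have hsymm : IsSymmSndFDerivAt ℝ f p :=
    hf.contDiffAt.isSymmSndFDerivAt 
      (by rw [minSmoothness_of_isRCLikeNormedField]; exact WithTop.coe_le_coe.2 le_top)
  rw [fderiv_clm_apply hd (differentiableAt_const v),
    fderiv_clm_apply hd (differentiableAt_const w)]
  simpa using hsymm.eq w v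

lemma contDiff_pxd (hf : ContDiff ℝ ∞ f) (i : Fin 3) : ContDiff ℝ ∞ (pxd i f) := by
  rw [pxd_eq_fderiv hf]
  exact contDiff_fderiv_apply_const hf _

lemma contDiff_ptd (hf : ContDiff ℝ ∞ f) : ContDiff ℝ ∞ (ptd f) := by
  rw [ptd_eq_fderiv hf]
  exact contDiff_fderiv_apply_const hf _

lemma pxd_comm (hf : ContDiff ℝ ∞ f) (i j : Fin 3) : pxd i (pxd j f) = pxd j (pxd i f) := by
  rw [pxd_eq_fderiv (contDiff_pxd hf j), pxd_eq_fderiv (contDiff_pxd hf i), pxd_eq_fderiv hf,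
    pxd_eq_fderiv hf]
  exact funext fun p => fderiv_fderiv_apply_comm hf _ _ p

lemma ptd_pxd_comm (hf : ContDiff ℝ ∞ f) (i : Fin 3) : ptd (pxd i f) = pxd i (ptd f) := by
  rw [ptd_eq_fderiv (contDiff_pxd hf i), pxd_eq_fderiv (contDiff_ptd hf), pxd_eq_fderiv hf,
    ptd_eq_fderiv hf]
  exact funext fun p => fderiv_fderiv_apply_comm hf _ _ p

lemma pxd_add (hf : ContDiff ℝ ∞ f) (hg : ContDiff ℝ ∞ g) (i : Fin 3) :
    pxd i (fun p => f p + g p) = fun p => pxd i f p + pxd i g p := by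
  funext p
  simp only [pxd]
  rw [fderiv_fun_add (hasFDerivAt_spatial_slice hf p).differentiableAt
    (hasFDerivAt_spatial_slice hg p).differentiableAt]
  rfl

lemma ptd_add (hf : ContDiff ℝ ∞ f) (hg : ContDiff ℝ ∞ g) :
    ptd (fun p => f p + g p) = fun p => ptd f p + ptd g p :=
  funext fun p => ((hasDerivAt_time_slice hf p).add (hasDerivAt_time_slice hg p)).deriv

lemma pxd_const_smul (hf : ContDiff ℝ ∞ f) (c : ℝ) (i : Fin 3) :
    pxd i (fun p => c • f p) = fun p => c • pxd i f p := by
  funext p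
  simp only [pxd]
  rw [fderiv_fun_const_smul (hasFDerivAt_spatial_slice hf p).differentiableAt]
  rfl

lemma ptd_const_smul (hf : ContDiff ℝ ∞ f) (c : ℝ) :
    ptd (fun p => c • f p) = fun p => c • ptd f p :=
  funext fun p => ((hasDerivAt_time_slice hf p).const_smul c).deriv

lemma contDiff_lap (hf : ContDiff ℝ ∞ f) : ContDiff ℝ ∞ (lap f) :=
  ContDiff.sum fun i _ => contDiff_pxd (contDiff_pxd hf i) i

lemma lap_add (hf : ContDiff ℝ ∞ f) (hg : ContDiff ℝ ∞ g) :
    lap (fun p => f p + g p) = fun p => lap f p + lap g p := by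
  funext p
  simp only [lap, pxd_add hf hg, pxd_add (contDiff_pxd hf _) (contDiff_pxd hg _),
    Finset.sum_add_distrib]

lemma lap_const_smul (hf : ContDiff ℝ ∞ f) (c : ℝ) :
    lap (fun p => c • f p) = fun p => c • lap f p := by
  funext p
  simp only [lap, pxd_const_smul hf, pxd_const_smul (contDiff_pxd hf _), Finset.smul_sum]

lemma pxd_sum {ι : Type*} (s : Finset ι) {F : ι → ℝ × V3 → E} (hF : ∀ k, ContDiff ℝ ∞ (F k))
    (i : Fin 3) : pxd i (fun p => ∑ k ∈ s, F k p) = fun p => ∑ k ∈ s, pxd i (F k) p := by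
  funext p
  simp only [pxd]
  rw [fderiv_fun_sum fun k _ => (hasFDerivAt_spatial_slice (hF k) p).differentiableAt]
  simp

lemma ptd_sum {ι : Type*} (s : Finset ι) {F : ι → ℝ × V3 → E} (hF : ∀ k, ContDiff ℝ ∞ (F k)) :
    ptd (fun p => ∑ k ∈ s, F k p) = fun p => ∑ k ∈ s, ptd (F k) p :=
  funext fun p => (HasDerivAt.fun_sum fun k _ => hasDerivAt_time_slice (hF k) p).deriv

lemma ptd_lap_comm (hf : ContDiff ℝ ∞ f) : ptd (lap f) = lap (ptd f) := by
  have h := ptd_sum Finset.univ fun i => contDiff_pxd (contDiff_pxd hf i) i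
  refine h.trans ?_
  funext p
  simp only [lap, ptd_pxd_comm (contDiff_pxd hf _), ptd_pxd_comm hf]

lemma pxd_lap_comm (hf : ContDiff ℝ ∞ f) (j : Fin 3) : pxd j (lap f) = lap (pxd j f) := by
  have h := pxd_sum Finset.univ (fun i => contDiff_pxd (contDiff_pxd hf i) i) j
  refine h.trans ?_
  funext p
  simp only [lap, pxd_comm (contDiff_pxd hf _) j, pxd_comm hf j]

/-- The d'Alembertian commutes with spatial derivatives. -/
lemma box_pxd_comm (μ₀ ε₀ : ℝ) (hf : ContDiff ℝ ∞ f) (i : Fin 3) :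
    box μ₀ ε₀ (pxd i f) = pxd i (box μ₀ ε₀ f) := by
  have hl := contDiff_lap hf
  have ht := contDiff_ptd (contDiff_ptd hf)
  have hc : ContDiff ℝ ∞ fun p => (-(μ₀ * ε₀)) • ptd (ptd f) p := ht.const_smul _
  have h : box μ₀ ε₀ f = fun p => lap f p + (-(μ₀ * ε₀)) • ptd (ptd f) p := by
    funext p; simp [box, sub_eq_add_neg]
  rw [h, pxd_add hl hc, pxd_const_smul ht, pxd_lap_comm hf,
    ← ptd_pxd_comm (contDiff_ptd hf), ← ptd_pxd_comm hf]
  funext p; simp [box, sub_eq_add_neg]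

/-- The d'Alembertian commutes with time derivatives. -/
lemma box_ptd_comm (μ₀ ε₀ : ℝ) (hf : ContDiff ℝ ∞ f) :
    box μ₀ ε₀ (ptd f) = ptd (box μ₀ ε₀ f) := by
  have hl := contDiff_lap hf
  have ht := contDiff_ptd (contDiff_ptd hf)
  have hc : ContDiff ℝ ∞ fun p => (-(μ₀ * ε₀)) • ptd (ptd f) p := ht.const_smul _
  have h : box μ₀ ε₀ f = fun p => lap f p + (-(μ₀ * ε₀)) • ptd (ptd f) p := by
    funext p; simp [box, sub_eq_add_neg]
  rw [h, ptd_add hl hc, ptd_const_smul ht, ptd_lap_comm hf]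
  funext p; simp [box, sub_eq_add_neg]

lemma box_const_smul (μ₀ ε₀ : ℝ) (hf : ContDiff ℝ ∞ f) (c : ℝ) :
    box μ₀ ε₀ (fun p => c • f p) = fun p => c • box μ₀ ε₀ f p := by
  funext p
  simp only [box, lap_const_smul hf, ptd_const_smul hf, ptd_const_smul (contDiff_ptd hf), smul_sub]
  rw [smul_comm c]

/-- A smooth function with vanishing time derivative is determined by its initial values. -/
lemma eq_zero_of_ptd_eq_zero (hf : ContDiff ℝ ∞ f) (h : ∀ p, ptd f p = 0)
    (h0 : ∀ x, f (0, x) = 0) (p : ℝ × V3) : f p = 0 := by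
  have hd : ∀ s, HasDerivAt (fun s => f (s, p.2)) 0 s := fun s => by
    simpa [h] using hasDerivAt_time_slice hf (s, p.2)
  have hc := is_const_of_deriv_eq_zero (fun s => (hd s).differentiableAt)
    (fun s => (hd s).deriv) p.1 0
  simpa [h0] using hc

end Calculus

section VectorFields

variable {F : ℝ × V3 → V3}

lemma pxd_apply (hF : ContDiff ℝ ∞ F) (i j : Fin 3) (p : ℝ × V3) :
    pxd i F p j = pxd i (fun q => F q j) p := by
  have h := (hasFDerivAt_pi'.1 (hasFDerivAt_spatial_slice hF p).differentiableAt.hasFDerivAt j)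
  simp [pxd, h.fderiv]

lemma ptd_apply (hF : ContDiff ℝ ∞ F) (j : Fin 3) (p : ℝ × V3) :
    ptd F p j = ptd (fun q => F q j) p :=
  ((hasDerivAt_pi.1 (hasDerivAt_time_slice hF p) j).deriv).symm

lemma box_apply (μ₀ ε₀ : ℝ) (hF : ContDiff ℝ ∞ F) (j : Fin 3) (p : ℝ × V3) :
    box μ₀ ε₀ F p j = box μ₀ ε₀ (fun q => F q j) p := by
  have hx : ∀ i, (fun q => pxd i F q j) = pxd i (fun q => F q j) :=
    fun i => funext (pxd_apply hF i j)
  have ht : (fun q => ptd F q j) = ptd (fun q => F q j) := funext (ptd_apply hF j)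
  simp only [box, lap, Pi.sub_apply, Finset.sum_apply, Pi.smul_apply]
  simp only [pxd_apply (contDiff_pxd hF _), ptd_apply (contDiff_ptd hF), hx, ht]

lemma contDiff_grad {f : ℝ × V3 → ℝ} (hf : ContDiff ℝ ∞ f) : ContDiff ℝ ∞ (grad f) :=
  contDiff_pi.2 fun i => contDiff_pxd hf i

lemma curl_grad {f : ℝ × V3 → ℝ} (hf : ContDiff ℝ ∞ f) (p : ℝ × V3) : curl (grad f) p = 0 := by
  simp only [curl, grad]
  change ![pxd 1 (pxd 2 f) p - pxd 2 (pxd 1 f) p, pxd 2 (pxd 0 f) p - pxd 0 (pxd 2 f) p,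
    pxd 0 (pxd 1 f) p - pxd 1 (pxd 0 f) p] = 0
  rw [pxd_comm hf 1 2, pxd_comm hf 2 0, pxd_comm hf 0 1]
  ext i; fin_cases i <;> simp

lemma divg_grad (f : ℝ × V3 → ℝ) : divg (grad f) = lap f := rfl

lemma box_grad_eq_zero (μ₀ ε₀ : ℝ) {f : ℝ × V3 → ℝ} (hf : ContDiff ℝ ∞ f)
    (h : ∀ p, box μ₀ ε₀ f p = 0) (p : ℝ × V3) : box μ₀ ε₀ (grad f) p = 0 := by
  ext j
  have h0 : box μ₀ ε₀ f = fun _ => 0 := funext h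
  rw [box_apply μ₀ ε₀ (contDiff_grad hf)]
  change box μ₀ ε₀ (pxd j f) p = 0
  rw [box_pxd_comm μ₀ ε₀ hf, h0]
  simp [pxd]

end VectorFields

section Antiderivative

/-- The integral over `[0, 1]` of a smooth family of functions is smooth in the parameter. -/
lemma contDiff_integral_unitInterval {P : Type} [NormedAddCommGroup P] [NormedSpace ℝ P]
    {H : P × ℝ → ℝ} (hH : ContDiff ℝ ∞ H) :
    ContDiff ℝ ∞ fun p => ∫ u in (0 : ℝ)..1, H (p, u) := by
  let χ : ContDiffBump (0 : ℝ) := ⟨1, 2, one_pos, one_lt_two⟩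
  let g : P → ℝ → ℝ := fun p x => χ x * H (p, -x)
  have hg : ContDiff ℝ ∞ ↿g :=
    (χ.contDiff.comp contDiff_snd).mul (hH.comp (contDiff_fst.prodMk contDiff_snd.neg))
  have hloc : LocallyIntegrable (Set.indicator (Set.Ioc (0 : ℝ) 1) fun _ => (1 : ℝ)) volume :=
    (locallyIntegrable_const 1).indicator measurableSet_Ioc
  have hconv := contDiffOn_convolution_right_with_param_comp (n := (⊤ : ℕ∞))
    (ContinuousLinearMap.mul ℝ ℝ) (s := (Set.univ : Set P)) (v := fun _ : P => (0 : ℝ))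
    (μ := volume) (g := g) (k := Metric.closedBall 0 2) contDiffOn_const isOpen_univ
    (isCompact_closedBall _ _)
    (fun p x _ hx => by
      have hx' : χ x = 0 := χ.zero_of_le_dist (by
        simpa [χ] using (not_le.1 fun h => hx (Metric.mem_closedBall.2 h)).le)
      simp [g, hx'])
    hloc hg.contDiffOn
  convert contDiffOn_univ.1 hconv using 2 with p
  rw [intervalIntegral.integral_of_le zero_le_one, ← integral_indicator measurableSet_Ioc,
    convolution_def]
  refine integral_congr_ae (Eventually.of_forall fun u => ?_)
  by_cases hu : u ∈ Set.Ioc (0 : ℝ) 1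
  · have hχ : χ (-u) = 1 := χ.one_of_mem_closedBall (by
      simpa [χ, abs_of_pos hu.1] using hu.2)
    simp [hu, g, hχ]
  · simp [hu]

/-- Every smooth function on spacetime has a smooth time antiderivative vanishing at time zero. -/
lemma exists_time_antiderivative {f : ℝ × V3 → ℝ} (hf : ContDiff ℝ ∞ f) :
    ∃ F : ℝ × V3 → ℝ, ContDiff ℝ ∞ F ∧ ptd F = f ∧ ∀ x, F (0, x) = 0 := by
  have hF : (fun p : ℝ × V3 => ∫ s in (0 : ℝ)..p.1, f (s, p.2)) =
      fun p => ∫ u in (0 : ℝ)..1, p.1 * f (p.1 * u, p.2) := by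
    funext p
    rw [intervalIntegral.integral_const_mul]
    simpa using (intervalIntegral.mul_integral_comp_mul_left
      (f := fun s => f (s, p.2)) (a := 0) (b := 1) p.1).symm
  refine ⟨fun p => ∫ s in (0 : ℝ)..p.1, f (s, p.2), ?_, ?_, by simp⟩
  · rw [hF]
    refine contDiff_integral_unitInterval
      (H := fun q : (ℝ × V3) × ℝ => q.1.1 * f (q.1.1 * q.2, q.1.2)) ?_
    fun_prop
  · funext p
    have hc : Continuous fun s => f (s, p.2) := hf.continuous.comp (by fun_prop)
    exact hc.deriv_integral _ 0 p.1

end Antiderivative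

section Schwartz

lemma contDiff_iterate_pxd {f : ℝ × V3 → ℝ} (hf : ContDiff ℝ ∞ f) (i : Fin 3) (n : ℕ) :
    ContDiff ℝ ∞ ((pxd i)^[n] f) := by
  induction n with
  | zero => exact hf
  | succ n ih => rw [Function.iterate_succ_apply']; exact contDiff_pxd ih i

lemma iterate_pxd_pxd_comm {f : ℝ × V3 → ℝ} (hf : ContDiff ℝ ∞ f) (i j : Fin 3) (n : ℕ) :
    (pxd i)^[n] (pxd j f) = pxd j ((pxd i)^[n] f) := by
  induction n with
  | zero => rfl
  | succ n ih =>
    rw [Function.iterate_succ_apply', Function.iterate_succ_apply', ih,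
      pxd_comm (contDiff_iterate_pxd hf i n)]

lemma SchwartzLocUnif.pxd {f : ℝ × V3 → ℝ} (hf : ContDiff ℝ ∞ f) (hS : SchwartzLocUnif f)
    (i : Fin 3) : SchwartzLocUnif (pxd i f) := by
  intro α β j R
  have h2 := contDiff_iterate_pxd hf 2 (β 2)
  have h1 := contDiff_iterate_pxd h2 1 (β 1)
  convert hS α (β + Pi.single i 1) j R using 8
  fin_cases i
  · simp [Function.iterate_succ_apply', iterate_pxd_pxd_comm hf, iterate_pxd_pxd_comm h2,
      iterate_pxd_pxd_comm h1]
  · simp [Function.iterate_succ_apply', iterate_pxd_pxd_comm hf, iterate_pxd_pxd_comm h2]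
  · simp [Function.iterate_succ_apply', iterate_pxd_pxd_comm hf]

lemma norm_pow_le_sum (x : V3) (k : ℕ) : ‖x‖ ^ k ≤ ∑ i, |x i| ^ k := by
  obtain ⟨i, -, hi⟩ := Finset.exists_mem_eq_sup Finset.univ Finset.univ_nonempty fun i => ‖x i‖₊
  rw [Pi.norm_def, hi, coe_nnnorm, Real.norm_eq_abs]
  exact Finset.single_le_sum (f := fun i => |x i| ^ k) (fun _ _ => by positivity)
    (Finset.mem_univ i)

lemma SchwartzLocUnif.decay {f : ℝ × V3 → ℝ} (hf : ContDiff ℝ ∞ f) (hS : SchwartzLocUnif f)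
    (k n : ℕ) :
    ∃ C, ∀ x : V3, ‖x‖ ^ k * ‖iteratedFDeriv ℝ n (fun y => f (0, y)) x‖ ≤ C := by
  induction n generalizing f with
  | zero =>
    choose C hC using fun i : Fin 3 => hS (Pi.single i k) 0 0 0
    refine ⟨∑ i, C i, fun x => ?_⟩
    rw [norm_iteratedFDeriv_zero]
    refine (mul_le_mul_of_nonneg_right (norm_pow_le_sum x k) (norm_nonneg _)).trans ?_
    rw [Finset.sum_mul]
    refine Finset.sum_le_sum fun i _ => ?_
    have h := hC i (0, x) (by simp)
    have hprod : ∏ l, x l ^ (Pi.single i k : Fin 3 → ℕ) l = x i ^ k := by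
      rw [Finset.prod_eq_single i] <;> simp +contextual
    simpa [hprod] using h
  | succ n ih =>
    choose C hC using fun i : Fin 3 => ih (contDiff_pxd hf i) (hS.pxd hf i)
    let proj : Fin 3 → V3 →L[ℝ] ℝ := fun i => ContinuousLinearMap.proj i
    let L : Fin 3 → ℝ →L[ℝ] V3 →L[ℝ] ℝ := fun i =>
      (ContinuousLinearMap.smulRightL ℝ V3 ℝ (proj i))
    have hslice : ∀ i, ContDiff ℝ ∞ fun y : V3 => _root_.pxd i f (0, y) := fun i =>
      (contDiff_pxd hf i).comp (contDiff_const.prodMk contDiff_id)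
    have hfd : fderiv ℝ (fun y : V3 => f (0, y)) =
        fun y => ∑ i, L i (_root_.pxd i f (0, y)) := by
      funext y
      ext v
      have hv : v = ∑ i, v i • (Pi.single i (1 : ℝ) : V3) := by
        simpa using (pi_eq_sum_univ' v)
      conv_lhs => rw [hv, map_sum]
      simp [L, proj, _root_.pxd]
    refine ⟨∑ i, ‖L i‖ * C i, fun x => ?_⟩
    have hsum : iteratedFDeriv ℝ n (fun y => ∑ i, L i (_root_.pxd i f (0, y))) x =
        ∑ i, iteratedFDeriv ℝ n (fun y => L i (_root_.pxd i f (0, y))) x :=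
      iteratedFDeriv_fun_sum_apply fun i _ =>
        ((L i).contDiff.comp ((hslice i).of_le (mod_cast le_top))).contDiffAt
    rw [← norm_iteratedFDeriv_fderiv, hfd, hsum]
    have hterm : ∀ i, ‖iteratedFDeriv ℝ n (fun y => L i (_root_.pxd i f (0, y))) x‖ ≤
        ‖L i‖ * ‖iteratedFDeriv ℝ n (fun y => _root_.pxd i f (0, y)) x‖ := fun i =>
      (L i).norm_iteratedFDeriv_comp_left (hslice i).contDiffAt (mod_cast le_top)
    calc _ ≤ ‖x‖ ^ k * ∑ i, ‖L i‖ * ‖iteratedFDeriv ℝ n (fun y => _root_.pxd i f (0, y)) x‖ := by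
            gcongr
            exact norm_sum_le_of_le _ fun i _ => hterm i
      _ = ∑ i, ‖L i‖ * (‖x‖ ^ k * ‖iteratedFDeriv ℝ n (fun y => _root_.pxd i f (0, y)) x‖) := by
            rw [Finset.mul_sum]
            exact Finset.sum_congr rfl fun i _ => by ring
      _ ≤ _ := Finset.sum_le_sum fun i _ =>
            mul_le_mul_of_nonneg_left (hC i x) (L i).opNorm_nonneg

end Schwartz

section FourierMultiplier

/-- Three-dimensional Euclidean space, the domain of the Fourier transform. -/
local notation "V₃" => EuclideanSpace ℝ (Fin 3)

lemma fderiv_fourier_apply {G : V₃ → ℂ} (hG : AEStronglyMeasurable G)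
    (hint : ∀ n : ℕ, Integrable fun v => ‖v‖ ^ n * ‖G v‖) (x e : V₃) :
    fderiv ℝ (𝓕 G) x e = 𝓕 (fun v => -(2 * π * Complex.I) * inner ℝ v e * G v) x := by
  have h0 : Integrable G := (integrable_norm_iff hG).1 (by simpa using hint 0)
  have h1 : Integrable fun v => ‖v‖ * ‖G v‖ := by simpa using hint 1
  have hR : Integrable (VectorFourier.fourierSMulRight (innerSL ℝ) G) :=
    (h1.const_mul (2 * π * ‖innerSL ℝ (E := V₃)‖)).mono' (hG.fourierSMulRight (L := innerSL ℝ))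
      (Eventually.of_forall fun v =>
        (VectorFourier.norm_fourierSMulRight_le _ _ _).trans_eq (by ring))
  rw [Real.fderiv_fourier h0 h1, Real.fourier_continuousLinearMap_apply hR]
  refine congrArg (fun g : V₃ → ℂ => 𝓕 g x) (funext fun v => ?_)
  simp only [VectorFourier.fourierSMulRight_apply, smul_eq_mul, Complex.real_smul, mul_assoc]
  rfl

lemma aestronglyMeasurable_inner_mul {G : V₃ → ℂ} (hG : AEStronglyMeasurable G) (e : V₃) :
    AEStronglyMeasurable fun v => -(2 * π * Complex.I) * inner ℝ v e * G v := by
  have hc : Continuous fun v : V₃ => -(2 * π * Complex.I) * ((inner ℝ v e : ℝ) : ℂ) := by fun_prop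
  exact hc.aestronglyMeasurable.mul hG

lemma integrable_pow_mul_inner_mul {G : V₃ → ℂ} (hG : AEStronglyMeasurable G)
    (hint : ∀ n : ℕ, Integrable fun v => ‖v‖ ^ n * ‖G v‖) (e : V₃) (n : ℕ) :
    Integrable fun v => ‖v‖ ^ n * ‖-(2 * π * Complex.I) * inner ℝ v e * G v‖ := by
  refine ((hint (n + 1)).const_mul (2 * π * ‖e‖)).mono'
    ((continuous_norm.pow n).aestronglyMeasurable.mul (aestronglyMeasurable_inner_mul hG e).norm)
    (Eventually.of_forall fun v => ?_)
  have h := norm_inner_le_norm (𝕜 := ℝ) v e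
  rw [norm_of_nonneg (by positivity)]
  simp only [norm_mul, norm_neg, Complex.norm_real, Complex.norm_I, Complex.norm_ofNat,
    norm_of_nonneg pi_pos.le]
  calc ‖v‖ ^ n * (2 * π * 1 * ‖inner ℝ v e‖ * ‖G v‖)
      ≤ ‖v‖ ^ n * (2 * π * 1 * (‖v‖ * ‖e‖) * ‖G v‖) := by gcongr
    _ = _ := by ring

lemma integrable_inv_norm_sq_mul_inv_one_add_norm_sq :
    Integrable fun v : V₃ => (‖v‖ ^ 2)⁻¹ * (1 + ‖v‖ ^ 2)⁻¹ := by
  rw [integrable_fun_norm_addHaar volume (f := fun r : ℝ => (r ^ 2)⁻¹ * (1 + r ^ 2)⁻¹)]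
  refine (integrable_inv_one_add_sq.integrableOn (s := Set.Ioi 0)).congr_fun (fun r hr => ?_)
    measurableSet_Ioi
  have hr' : r ≠ 0 := (Set.mem_Ioi.1 hr).ne'
  simp [hr']

/-- Dividing a Schwartz function on three-space by `‖v‖²` keeps all moments integrable. -/
lemma integrable_pow_mul_inv_norm_sq_mul (f : SchwartzMap V₃ ℂ) (n : ℕ) :
    Integrable fun v : V₃ => ‖v‖ ^ n * ((‖v‖ ^ 2)⁻¹ * ‖f v‖) := by
  obtain ⟨C₁, -, h₁⟩ := f.decay n 0
  obtain ⟨C₂, -, h₂⟩ := f.decay (n + 2) 0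
  have hm : Measurable fun v : V₃ => ‖v‖ ^ n * ((‖v‖ ^ 2)⁻¹ * ‖f v‖) :=
    (measurable_norm.pow_const n).mul
      ((measurable_norm.pow_const 2).inv.mul f.continuous.measurable.norm)
  refine (integrable_inv_norm_sq_mul_inv_one_add_norm_sq.const_mul (C₁ + C₂)).mono'
    hm.aestronglyMeasurable (Eventually.of_forall fun v => ?_)
  have h1 := h₁ v
  have h2 := h₂ v
  rw [norm_iteratedFDeriv_zero] at h1 h2
  rw [norm_of_nonneg (by positivity)]
  have hb : ‖v‖ ^ n * ‖f v‖ ≤ (C₁ + C₂) * (1 + ‖v‖ ^ 2)⁻¹ := by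
    rw [← div_eq_mul_inv, le_div_iff₀ (by positivity)]
    linarith [show ‖v‖ ^ n * ‖f v‖ * (1 + ‖v‖ ^ 2) =
      ‖v‖ ^ n * ‖f v‖ + ‖v‖ ^ (n + 2) * ‖f v‖ by ring]
  calc _ = (‖v‖ ^ 2)⁻¹ * (‖v‖ ^ n * ‖f v‖) := by ring
    _ ≤ (‖v‖ ^ 2)⁻¹ * ((C₁ + C₂) * (1 + ‖v‖ ^ 2)⁻¹) := by gcongr
    _ = _ := by ring

/-- The Poisson equation on three-space with Schwartz right-hand side has a smooth solution. -/
lemma SchwartzMap.exists_poisson (f : SchwartzMap V₃ ℂ) :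
    ∃ u : V₃ → ℂ, ContDiff ℝ ∞ u ∧ ∀ x,
      ∑ i, fderiv ℝ (fun y => fderiv ℝ u y (EuclideanSpace.single i 1)) x
        (EuclideanSpace.single i 1) = f x := by
  let G : V₃ → ℂ := fun v => ((2 * π * Complex.I) ^ 2 * (‖v‖ : ℂ) ^ 2)⁻¹ * (𝓕⁻ f) v
  have hGm : Measurable G :=
    ((Complex.measurable_ofReal.comp measurable_norm).pow_const 2 |>.const_mul _ |>.inv).mul
      (𝓕⁻ f).continuous.measurable
  have hG := hGm.aestronglyMeasurable (μ := volume)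
  have hint : ∀ n : ℕ, Integrable fun v => ‖v‖ ^ n * ‖G v‖ := fun n => by
    refine ((integrable_pow_mul_inv_norm_sq_mul (𝓕⁻ f) n).const_mul
      ((2 * π) ^ 2)⁻¹).congr (Eventually.of_forall fun v => ?_)
    simp [G, norm_of_nonneg pi_pos.le]
    ring
  refine ⟨𝓕 G, Real.contDiff_fourier fun n _ => hint n, fun x => ?_⟩
  have hfd : ∀ e, fderiv ℝ (fun y => fderiv ℝ (𝓕 G) y e) x e =
      𝓕 (fun v => -(2 * π * Complex.I) * inner ℝ v e *
        (-(2 * π * Complex.I) * inner ℝ v e * G v)) x := fun e => by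
    rw [← fderiv_fourier_apply (aestronglyMeasurable_inner_mul hG e)
      (integrable_pow_mul_inner_mul hG hint e)]
    congr 2
    funext y
    exact fderiv_fourier_apply hG hint y e
  simp only [hfd, Real.fourier_eq]
  rw [← integral_finsetSum]
  · have hinv : 𝓕 (𝓕⁻ f) x = f x := by rw [FourierTransform.fourier_fourierInv_eq]
    rw [← hinv, SchwartzMap.fourier_coe, Real.fourier_eq]
    refine integral_congr_ae ?_
    have hne : ∀ᵐ v : V₃, v ≠ 0 := by
      simp [ae_iff]
    filter_upwards [hne] with v hv
    rw [← Finset.smul_sum]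
    congr 1
    have hn : (‖v‖ : ℂ) ≠ 0 := by simpa using hv
    have hsum : ((v 0 : ℝ) : ℂ) ^ 2 + (v 1 : ℂ) ^ 2 + (v 2 : ℂ) ^ 2 = (‖v‖ : ℂ) ^ 2 := by
      have := EuclideanSpace.real_norm_sq_eq v
      rw [Fin.sum_univ_three] at this
      exact_mod_cast this.symm
    have hpi : (π : ℂ) ≠ 0 := by simp [pi_ne_zero]
    simp only [Fin.sum_univ_three, EuclideanSpace.inner_single_right, G]
    simp
    field_simp
    rw [← hsum]
    ring
  · intro i _
    have hm := aestronglyMeasurable_inner_mul (aestronglyMeasurable_inner_mul hG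
      (EuclideanSpace.single i 1)) (EuclideanSpace.single i 1)
    have hi := integrable_pow_mul_inner_mul (aestronglyMeasurable_inner_mul hG
      (EuclideanSpace.single i 1)) (integrable_pow_mul_inner_mul hG hint _)
      (EuclideanSpace.single i 1) 0
    exact (Real.fourierIntegral_convergent_iff x).2
      ((integrable_norm_iff hm).1 (by simpa using hi))

/-- A smooth static potential whose Laplacian is the restriction of `f` to time zero. -/
lemma SchwartzLocUnif.exists_static_potential {f : ℝ × V3 → ℝ} (hf : ContDiff ℝ ∞ f)
    (hS : SchwartzLocUnif f) :
    ∃ φ : ℝ × V3 → ℝ, ContDiff ℝ ∞ φ ∧ (∀ p, ptd φ p = 0) ∧ ∀ p, lap φ p = f (0, p.2) := by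
  let h : SchwartzMap V3 ℝ :=
    ⟨fun x => f (0, x), hf.comp (contDiff_const.prodMk contDiff_id), fun k n => hS.decay hf k n⟩
  let e : V₃ ≃L[ℝ] V3 := EuclideanSpace.equiv (Fin 3) ℝ
  let hE : SchwartzMap V₃ ℂ := (SchwartzMap.compCLMOfContinuousLinearEquiv ℝ e h).postcompCLM
    (Complex.ofRealCLM)
  obtain ⟨u, hu, hlap⟩ := hE.exists_poisson
  have key : ∀ (w : V₃ → ℂ), ContDiff ℝ ∞ w → ∀ i,
      _root_.pxd i (fun p => (w (e.symm p.2)).re) =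
        fun p => (fderiv ℝ w (e.symm p.2) (EuclideanSpace.single i 1)).re := fun w hw i => by
    funext p
    have hd : HasFDerivAt (fun y : V3 => (w (e.symm y)).re) _ p.2 :=
      Complex.reCLM.hasFDerivAt.comp p.2
        (((hw.differentiable (by simp)) (e.symm p.2)).hasFDerivAt.comp p.2 e.symm.hasFDerivAt)
    simp only [_root_.pxd, hd.fderiv]
    rfl
  refine ⟨fun p => (u (e.symm p.2)).re, Complex.reCLM.contDiff.comp
    (hu.comp (e.symm.contDiff.comp contDiff_snd)), fun p => by simp [ptd], fun p => ?_⟩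
  have hu' : ∀ v, ContDiff ℝ ∞ fun y => fderiv ℝ u y v := fun v =>
    (hu.fderiv_right (m := ∞) (by simp)).clm_apply contDiff_const
  simp only [lap, key u hu, key _ (hu' _)]
  rw [← Complex.re_sum, hlap]
  simp [hE]
  rfl

end FourierMultiplier

/-- A solution of the wave equation with `∂ρ/∂t(0, ·) = 0` is the Laplacian of a potential that
itself solves the wave equation. -/
lemma exists_wave_potential {ε₀ μ₀ : ℝ} (hεμ : μ₀ * ε₀ ≠ 0) {ρ : ℝ × V3 → ℝ}
    (hρ : ContDiff ℝ ∞ ρ) (hS : SchwartzLocUnif ρ) (hwave : ∀ p, box μ₀ ε₀ ρ p = 0)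
    (hinit : ∀ x, ptd ρ (0, x) = 0) :
    ∃ φ : ℝ × V3 → ℝ, ContDiff ℝ ∞ φ ∧ lap φ = ρ ∧ ∀ p, box μ₀ ε₀ φ p = 0 := by
  obtain ⟨φ₀, hφ₀, hφ₀t, hφ₀l⟩ := hS.exists_static_potential hρ
  obtain ⟨A, hA, hAt, hA0⟩ := exists_time_antiderivative hρ
  obtain ⟨B, hB, hBt, hB0⟩ := exists_time_antiderivative hA
  set c := (μ₀ * ε₀)⁻¹ with hc
  have hcB : ContDiff ℝ ∞ fun p => c • B p := hB.const_smul _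
  have hcA : ContDiff ℝ ∞ fun p => c • A p := hA.const_smul _
  let φ : ℝ × V3 → ℝ := fun p => φ₀ p + c • B p
  have hφ : ContDiff ℝ ∞ φ := hφ₀.add hcB
  have hφt : ptd φ = fun p => c • A p := by
    rw [ptd_add hφ₀ hcB, ptd_const_smul hB, hBt]
    simp [hφ₀t]
  have hφtt : ptd (ptd φ) = fun p => c • ρ p := by rw [hφt, ptd_const_smul hA, hAt]
  have hzero : ∀ (F : ℝ × V3 → ℝ), (∀ x, F (0, x) = 0) → ∀ x, lap F (0, x) = 0 :=
    fun F hF x => by simp [lap, pxd, hF]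
  let w : ℝ × V3 → ℝ := fun p => lap φ p + (-1 : ℝ) • ρ p
  have hnρ : ContDiff ℝ ∞ fun p => (-1 : ℝ) • ρ p := hρ.const_smul _
  have hnρt : ContDiff ℝ ∞ fun p => (-1 : ℝ) • ptd ρ p := (contDiff_ptd hρ).const_smul _
  have hw : ContDiff ℝ ∞ w := (contDiff_lap hφ).add hnρ
  have hwt : ptd w = fun p => lap (fun q => c • A q) p + (-1 : ℝ) • ptd ρ p := by
    rw [ptd_add (contDiff_lap hφ) hnρ, ptd_const_smul hρ, ptd_lap_comm hφ, hφt]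
  have hwtt : ∀ p, ptd (ptd w) p = 0 := fun p => by
    rw [hwt, ptd_add (contDiff_lap hcA) hnρt, ptd_const_smul (contDiff_ptd hρ),
      ptd_lap_comm hcA, ptd_const_smul hA, hAt, lap_const_smul hρ]
    have h := hwave p
    simp only [box, smul_eq_mul] at h ⊢
    rw [sub_eq_zero.1 h, hc, inv_mul_cancel_left₀ hεμ]
    ring
  have hw0 : ∀ p, w p = 0 := by
    refine eq_zero_of_ptd_eq_zero hw (eq_zero_of_ptd_eq_zero (contDiff_ptd hw) hwtt fun x => ?_)
      fun x => ?_
    · rw [hwt]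
      simp only [hinit, hzero (fun q => c • A q) (by simp [hA0]), smul_zero, add_zero]
    · simp only [w, φ]
      rw [lap_add hφ₀ hcB]
      simp [-smul_eq_mul, hφ₀l, hzero (fun q => c • B q) (by simp [hB0])]
  have hlap : lap φ = ρ := funext fun p => by
    have := hw0 p
    simp only [w, smul_eq_mul] at this
    linarith
  refine ⟨φ, hφ, hlap, fun p => ?_⟩
  simp only [box, hlap, hφtt, hc, smul_smul, mul_inv_cancel₀ hεμ, one_smul, sub_self]

/-- a smoothly decaying solution of `□²ρ = 0` with `∂ρ/∂t(0,·) = 0`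
extends to `(ρ, J, E, B)` satisfying Maxwell's equations with `curl J = 0`,
`□²J = 0`, `□²E = 0` and `B = 0` (hence vanishing Poynting vector). -/
theorem stmt_7 (ε₀ μ₀ : ℝ) (hε : 0 < ε₀) (hμ : 0 < μ₀)
    (ρ : ℝ × V3 → ℝ) (hρ : ContDiff ℝ (⊤ : ℕ∞) ρ) (hS : SchwartzLocUnif ρ)
    (hwave : ∀ p : ℝ × V3, box μ₀ ε₀ ρ p = 0)
    (hinit : ∀ x : V3, ptd ρ (0, x) = 0) :
    ∃ J E B : ℝ × V3 → V3,
      ContDiff ℝ (⊤ : ℕ∞) J ∧ ContDiff ℝ (⊤ : ℕ∞) E ∧ ContDiff ℝ (⊤ : ℕ∞) B ∧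
      (∀ p : ℝ × V3, ptd ρ p + divg J p = 0) ∧
      (∀ p : ℝ × V3, curl J p = 0) ∧
      (∀ p : ℝ × V3, box μ₀ ε₀ J p = 0) ∧
      Maxwell ε₀ μ₀ ρ J E B ∧
      (∀ p : ℝ × V3, box μ₀ ε₀ E p = 0) ∧
      (∀ p : ℝ × V3, B p = 0) ∧
      (∀ p : ℝ × V3, cross3 (E p) (B p) = 0) := by
  obtain ⟨φ, hφ, hlap, hbox⟩ :=
    exists_wave_potential (mul_pos hμ hε).ne' hρ hS hwave hinit
  have hψ : ContDiff ℝ ∞ fun p => ε₀⁻¹ • φ p := hφ.const_smul _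
  have hbψ : ∀ p, box μ₀ ε₀ (fun p => ε₀⁻¹ • φ p) p = 0 := fun p => by
    simp only [box_const_smul μ₀ ε₀ hφ, hbox, smul_zero]
  have hχ : ContDiff ℝ ∞ fun p => (-1 : ℝ) • ptd φ p := (contDiff_ptd hφ).const_smul _
  have hbχ : ∀ p, box μ₀ ε₀ (fun p => (-1 : ℝ) • ptd φ p) p = 0 := fun p => by
    rw [box_const_smul μ₀ ε₀ (contDiff_ptd hφ), box_ptd_comm μ₀ ε₀ hφ,
      show box μ₀ ε₀ φ = fun _ => 0 from funext hbox]
    simp [ptd]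
  refine ⟨grad fun p => (-1 : ℝ) • ptd φ p, grad fun p => ε₀⁻¹ • φ p, fun _ => 0,
    contDiff_grad hχ, contDiff_grad hψ, contDiff_const, fun p => ?_, curl_grad hχ,
    box_grad_eq_zero μ₀ ε₀ hχ hbχ, fun p => ⟨?_, ?_, ?_, ?_⟩, box_grad_eq_zero μ₀ ε₀ hψ hbψ,
    fun _ => rfl, fun p => ?_⟩
  · rw [divg_grad, lap_const_smul (contDiff_ptd hφ), ← ptd_lap_comm hφ, hlap]
    simp
  · simp only [divg_grad, lap_const_smul hφ, hlap]
    rw [smul_eq_mul, inv_mul_eq_div]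
  · simp [divg, pxd]
  · rw [curl_grad hψ]
    simp [ptd]
  · ext j
    have hcurl : curl (fun _ => (0 : V3)) p = 0 := by
      ext i; fin_cases i <;> simp [curl, pxd]
    rw [hcurl, Pi.add_apply, Pi.smul_apply, Pi.smul_apply, ptd_apply (contDiff_grad hψ)]
    change 0 = μ₀ • pxd j (fun p => (-1 : ℝ) • ptd φ p) p +
      (μ₀ * ε₀) • ptd (pxd j fun p => ε₀⁻¹ • φ p) p
    rw [ptd_pxd_comm hψ, ptd_const_smul hφ, pxd_const_smul (contDiff_ptd hφ),
      pxd_const_smul (contDiff_ptd hφ)]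
    simp only [smul_eq_mul]
    field_simp
    ring
  · ext i; fin_cases i <;> simp [cross3]
end
end
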